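/- Let L > 0, Ra ∈ ℝ, T > 0, and let (θ'₁, θ̄₁, u₁, v₁, w₁, ω₁, ψ₁) and (θ'₂, θ̄₂, u₂, v₂, w₂, ω₂, ψ₂) be two smooth solutions of the infinite-Prandtl-number convection system on ℝ³ × [0,T] (as specified in the context). If θ'₁(·,0) = θ'₂(·,0), then for all t ∈ [0,T] one has θ'₁(·,t) = θ'₂(·,t), u₁(·,t) = u₂(·,t), v₁(·,t) = v₂(·,t), w₁(·,t) = w₂(·,t), and θ̄₁(·,t) = θ̄₂(·,t). -/

import Mathlib

noncomputable section
open Real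

/-- Functions of `(x, y, z, t)`. -/
abbrev F4 := ℝ → ℝ → ℝ → ℝ → ℝ

def px (f : F4) : F4 := fun x y z t => deriv (fun s => f s y z t) x
def py (f : F4) : F4 := fun x y z t => deriv (fun s => f x s z t) y
def pz (f : F4) : F4 := fun x y z t => deriv (fun s => f x y s t) z
def pt (f : F4) : F4 := fun x y z t => deriv (fun s => f x y z s) t

/-- Horizontal Laplacian `Δ_h = ∂²_x + ∂²_y`. -/
def lapH (f : F4) : F4 := fun x y z t => px (px f) x y z t + py (py f) x y z t

/-- The horizontal mean `(1/(4π²L²)) ∫_{[0,2πL]²} f dx dy`. -/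
def hmean (L : ℝ) (f : F4) (z t : ℝ) : ℝ :=
  (1/(4*π^2*L^2)) * ∫ y in (0:ℝ)..(2*π*L), ∫ x in (0:ℝ)..(2*π*L), f x y z t

/-- Smoothness on `ℝ³ × D` (jointly in all four variables). -/
def SmoothF4 (f : F4) (D : Set ℝ) : Prop :=
  ContDiffOn ℝ (⊤ : ℕ∞) (fun p : ℝ × ℝ × ℝ × ℝ => f p.1 p.2.1 p.2.2.1 p.2.2.2)
    {p : ℝ × ℝ × ℝ × ℝ | p.2.2.2 ∈ D}

/-- Spatial periodicity: period `2πL` in `x` and `y`, period `2π` in `z`. -/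
def PeriodicF4 (L : ℝ) (f : F4) : Prop :=
  (∀ x y z t, f (x + 2*π*L) y z t = f x y z t) ∧
  (∀ x y z t, f x (y + 2*π*L) z t = f x y z t) ∧
  (∀ x y z t, f x y (z + 2*π) t = f x y z t)

/-- A smooth solution of the infinite-Prandtl-number rapidly rotating convection system
on `ℝ³ × D`. -/
structure IsSolution (L Ra : ℝ) (D : Set ℝ)
    (θ' : F4) (θb : ℝ → ℝ → ℝ) (u v w ω ψ : F4) : Prop where
  smooth_θ' : SmoothF4 θ' D
  smooth_u : SmoothF4 u D
  smooth_v : SmoothF4 v D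
  smooth_w : SmoothF4 w D
  smooth_ω : SmoothF4 ω D
  smooth_ψ : SmoothF4 ψ D
  smooth_θb : ContDiffOn ℝ (⊤ : ℕ∞) (fun p : ℝ × ℝ => θb p.1 p.2) {p : ℝ × ℝ | p.2 ∈ D}
  per_θ' : PeriodicF4 L θ'
  per_u : PeriodicF4 L u
  per_v : PeriodicF4 L v
  per_w : PeriodicF4 L w
  per_ω : PeriodicF4 L ω
  per_ψ : PeriodicF4 L ψ
  per_θb : ∀ z t, θb (z + 2*π) t = θb z t
  /-- `∂_z ψ = Ra θ' + Δ_h w` -/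
  eq_psi : ∀ x y z : ℝ, ∀ t ∈ D, pz ψ x y z t = Ra * θ' x y z t + lapH w x y z t
  /-- `−∂_z w = Δ_h ω` -/
  eq_w : ∀ x y z : ℝ, ∀ t ∈ D, -pz w x y z t = lapH ω x y z t
  /-- `∂_t θ' + u ∂_x θ' + v ∂_y θ' + w ∂_z θ̄ = Δ_h θ'` -/
  eq_heat : ∀ x y z : ℝ, ∀ t ∈ D,
    pt θ' x y z t + u x y z t * px θ' x y z t + v x y z t * py θ' x y z t
      + w x y z t * deriv (fun s => θb s t) z = lapH θ' x y z t
  /-- `∂_z (mean of θ' w) = ∂²_z θ̄` -/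
  eq_mean : ∀ z : ℝ, ∀ t ∈ D,
    deriv (fun s => hmean L (fun x y z' t' => θ' x y z' t' * w x y z' t') s t) z
      = deriv (deriv (fun s => θb s t)) z
  /-- `∂_x u + ∂_y v = 0` -/
  div_free : ∀ x y z : ℝ, ∀ t ∈ D, px u x y z t + py v x y z t = 0
  /-- `ω = ∂_x v − ∂_y u` -/
  def_ω : ∀ x y z : ℝ, ∀ t ∈ D, ω x y z t = px v x y z t - py u x y z t
  /-- `Δ_h ψ = ω` -/
  def_ψ : ∀ x y z : ℝ, ∀ t ∈ D, lapH ψ x y z t = ω x y z t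
  /-- `u = −∂_y ψ` -/
  def_u : ∀ x y z : ℝ, ∀ t ∈ D, u x y z t = -py ψ x y z t
  /-- `v = ∂_x ψ` -/
  def_v : ∀ x y z : ℝ, ∀ t ∈ D, v x y z t = px ψ x y z t
  mean_θ' : ∀ z : ℝ, ∀ t ∈ D, hmean L θ' z t = 0
  mean_u : ∀ z : ℝ, ∀ t ∈ D, hmean L u z t = 0
  mean_v : ∀ z : ℝ, ∀ t ∈ D, hmean L v z t = 0
  mean_w : ∀ z : ℝ, ∀ t ∈ D, hmean L w z t = 0
  mean_ω : ∀ z : ℝ, ∀ t ∈ D, hmean L ω z t = 0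
  mean_ψ : ∀ z : ℝ, ∀ t ∈ D, hmean L ψ z t = 0
  mean_θb : ∀ t ∈ D, (∫ z in (0:ℝ)..(2*π), θb z t) = 0

/-- Integral over `Ω = [0,2πL]² × [0,2π]` at time `t`. -/
def intOmega (L : ℝ) (g : F4) (t : ℝ) : ℝ :=
  ∫ z in (0:ℝ)..(2*π), ∫ y in (0:ℝ)..(2*π*L), ∫ x in (0:ℝ)..(2*π*L), g x y z t

section Preliminaries

open MeasureTheory Set Filter Topology

section Integration

variable {X : Type*} [TopologicalSpace X] [MeasurableSpace X] [OpensMeasurableSpace X]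

theorem Continuous.integrable_of_ae_mem_isCompact {μ : Measure X} [IsFiniteMeasure μ] {K : Set X}
    (hK : IsCompact K) (hμ : ∀ᵐ p ∂μ, p ∈ K) {f : X → ℝ} (hf : Continuous f) :
    Integrable f μ := by
  obtain ⟨C, hC⟩ := hK.exists_bound_of_continuousOn hf.continuousOn
  exact Integrable.of_bound hf.aestronglyMeasurable C (hμ.mono fun p hp => hC p hp)

theorem hasDerivAt_integral_of_bounded_deriv {μ : Measure X} [IsFiniteMeasure μ] {K : Set X}
    (hK : IsCompact K) (hμ : ∀ᵐ p ∂μ, p ∈ K) {F F' : ℝ → X → ℝ} {t₀ C : ℝ} {s : Set ℝ}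
    (hs : s ∈ 𝓝 t₀) (hF : ∀ t ∈ s, Continuous (F t)) (hF' : Continuous (F' t₀))
    (hC : ∀ t ∈ s, ∀ p ∈ K, |F' t p| ≤ C)
    (hderiv : ∀ p, ∀ t ∈ s, HasDerivAt (F · p) (F' t p) t) :
    HasDerivAt (fun t => ∫ p, F t p ∂μ) (∫ p, F' t₀ p ∂μ) t₀ :=
  (hasDerivAt_integral_of_dominated_loc_of_deriv_le (bound := fun _ => C) hs
    (eventually_of_mem hs fun t ht => (hF t ht).aestronglyMeasurable)
    ((hF t₀ (mem_of_mem_nhds hs)).integrable_of_ae_mem_isCompact hK hμ)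
    hF'.aestronglyMeasurable (hμ.mono fun p hp t ht => hC t ht p hp) (integrable_const C)
    (Eventually.of_forall hderiv)).2

end Integration

/-- Lebesgue measure on one period `(0, a]`. -/
def cellMeasure (a : ℝ) : Measure ℝ := volume.restrict (Ioc 0 a)

/-- Lebesgue measure on the horizontal cell `(0, a]²`. -/
def squareMeasure (a : ℝ) : Measure (ℝ × ℝ) := (cellMeasure a).prod (cellMeasure a)

/-- Lebesgue measure on the cell `(0, a]² × (0, c]`. -/
def boxMeasure (a c : ℝ) : Measure ((ℝ × ℝ) × ℝ) := (squareMeasure a).prod (cellMeasure c)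

instance (a : ℝ) : IsFiniteMeasure (cellMeasure a) := by
  unfold cellMeasure; infer_instance

instance (a : ℝ) : IsFiniteMeasure (squareMeasure a) := by
  unfold squareMeasure; infer_instance

instance (a c : ℝ) : IsFiniteMeasure (boxMeasure a c) := by
  unfold boxMeasure; infer_instance

theorem squareMeasure_eq_restrict (a : ℝ) :
    squareMeasure a = volume.restrict (Ioc 0 a ×ˢ Ioc 0 a) := by
  rw [squareMeasure, cellMeasure, Measure.prod_restrict]; rfl

theorem boxMeasure_eq_restrict (a c : ℝ) :
    boxMeasure a c = volume.restrict ((Ioc 0 a ×ˢ Ioc 0 a) ×ˢ Ioc 0 c) := by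
  rw [boxMeasure, squareMeasure_eq_restrict, cellMeasure, Measure.prod_restrict]; rfl

theorem ae_mem_cell (a : ℝ) : ∀ᵐ x ∂cellMeasure a, x ∈ Icc 0 a :=
  (ae_restrict_mem measurableSet_Ioc).mono fun _ hx => Ioc_subset_Icc_self hx

theorem ae_mem_square (a : ℝ) : ∀ᵐ p ∂squareMeasure a, p ∈ Icc 0 a ×ˢ Icc 0 a := by
  rw [squareMeasure_eq_restrict]
  exact (ae_restrict_mem (measurableSet_Ioc.prod measurableSet_Ioc)).mono fun _ hx =>
    Set.prod_mono Ioc_subset_Icc_self Ioc_subset_Icc_self hx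

theorem ae_mem_box (a c : ℝ) :
    ∀ᵐ p ∂boxMeasure a c, p ∈ (Icc 0 a ×ˢ Icc 0 a) ×ˢ Icc 0 c := by
  rw [boxMeasure_eq_restrict]
  exact (ae_restrict_mem
    ((measurableSet_Ioc.prod measurableSet_Ioc).prod measurableSet_Ioc)).mono fun _ hx =>
    Set.prod_mono (Set.prod_mono Ioc_subset_Icc_self Ioc_subset_Icc_self) Ioc_subset_Icc_self hx

theorem isCompact_square (a : ℝ) : IsCompact (Icc 0 a ×ˢ Icc 0 a) :=
  isCompact_Icc.prod isCompact_Icc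

theorem isCompact_box (a c : ℝ) : IsCompact ((Icc 0 a ×ˢ Icc 0 a) ×ˢ Icc 0 c) :=
  (isCompact_square a).prod isCompact_Icc

theorem Continuous.integrable_cell {f : ℝ → ℝ} (hf : Continuous f) (a : ℝ) :
    Integrable f (cellMeasure a) :=
  hf.integrable_of_ae_mem_isCompact isCompact_Icc (ae_mem_cell a)

theorem Continuous.integrable_square {f : ℝ × ℝ → ℝ} (hf : Continuous f) (a : ℝ) :
    Integrable f (squareMeasure a) :=
  hf.integrable_of_ae_mem_isCompact (isCompact_square a) (ae_mem_square a)

theorem Continuous.integrable_box {f : (ℝ × ℝ) × ℝ → ℝ} (hf : Continuous f) (a c : ℝ) :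
    Integrable f (boxMeasure a c) :=
  hf.integrable_of_ae_mem_isCompact (isCompact_box a c) (ae_mem_box a c)

theorem integral_cell {a : ℝ} (ha : 0 ≤ a) (f : ℝ → ℝ) :
    ∫ x, f x ∂cellMeasure a = ∫ x in (0 : ℝ)..a, f x :=
  (intervalIntegral.integral_of_le ha).symm

theorem integral_cell_const {a : ℝ} (ha : 0 ≤ a) (C : ℝ) : ∫ _, C ∂cellMeasure a = a * C := by
  simp [integral_cell ha]

theorem integral_square {f : ℝ × ℝ → ℝ} (hf : Continuous f) (a : ℝ) :
    ∫ p, f p ∂squareMeasure a = ∫ x, ∫ y, f (x, y) ∂cellMeasure a ∂cellMeasure a :=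
  integral_prod f (hf.integrable_square a)

theorem integral_square_symm {f : ℝ × ℝ → ℝ} (hf : Continuous f) (a : ℝ) :
    ∫ p, f p ∂squareMeasure a = ∫ y, ∫ x, f (x, y) ∂cellMeasure a ∂cellMeasure a :=
  integral_prod_symm f (hf.integrable_square a)

theorem integral_box {f : (ℝ × ℝ) × ℝ → ℝ} (hf : Continuous f) (a c : ℝ) :
    ∫ p, f p ∂boxMeasure a c = ∫ q, ∫ z, f (q, z) ∂cellMeasure c ∂squareMeasure a :=
  integral_prod f (hf.integrable_box a c)

theorem integral_box_symm {f : (ℝ × ℝ) × ℝ → ℝ} (hf : Continuous f) (a c : ℝ) :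
    ∫ p, f p ∂boxMeasure a c = ∫ z, ∫ q, f (q, z) ∂squareMeasure a ∂cellMeasure c :=
  integral_prod_symm f (hf.integrable_box a c)

protected theorem Continuous.integral_cell {X : Type*} [TopologicalSpace X]
    [FirstCountableTopology X] [LocallyCompactSpace X] {f : X → ℝ → ℝ} (hf : Continuous f.uncurry) (a : ℝ) :
    Continuous fun x => ∫ s, f x s ∂cellMeasure a := by
  have := continuous_parametric_integral_of_continuous (μ := volume) hf
    (isCompact_Icc (a := 0) (b := a))
  simpa only [cellMeasure, ← integral_Icc_eq_integral_Ioc] using this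

protected theorem Continuous.integral_square {X : Type*} [TopologicalSpace X]
    [FirstCountableTopology X] [LocallyCompactSpace X] {f : X → ℝ × ℝ → ℝ} (hf : Continuous f.uncurry) (a : ℝ) :
    Continuous fun x => ∫ q, f x q ∂squareMeasure a := by
  have h (x : X) : ∫ q, f x q ∂squareMeasure a
      = ∫ s, ∫ r, f x (s, r) ∂cellMeasure a ∂cellMeasure a :=
    integral_square (hf.comp (by fun_prop : Continuous fun q : ℝ × ℝ => (x, q))) a
  simp only [h]
  refine Continuous.integral_cell (f := fun x s => ∫ r, f x (s, r) ∂cellMeasure a) ?_ a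
  exact Continuous.integral_cell (f := fun (p : X × ℝ) r => f p.1 (p.2, r))
    (hf.comp (by fun_prop : Continuous fun p : (X × ℝ) × ℝ => (p.1.1, (p.1.2, p.2)))) a

protected theorem Continuous.integral_box {X : Type*} [TopologicalSpace X]
    [FirstCountableTopology X] [LocallyCompactSpace X] {f : X → (ℝ × ℝ) × ℝ → ℝ} (hf : Continuous f.uncurry) (a c : ℝ) :
    Continuous fun x => ∫ q, f x q ∂boxMeasure a c := by
  have h (x : X) : ∫ q, f x q ∂boxMeasure a c
      = ∫ s, ∫ r, f x (s, r) ∂cellMeasure c ∂squareMeasure a :=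
    integral_box (hf.comp (by fun_prop : Continuous fun q : (ℝ × ℝ) × ℝ => (x, q))) a c
  simp only [h]
  refine Continuous.integral_square (f := fun x s => ∫ r, f x (s, r) ∂cellMeasure c) ?_ a
  exact Continuous.integral_cell (f := fun (p : X × (ℝ × ℝ)) r => f p.1 (p.2, r))
    (hf.comp (by fun_prop : Continuous fun p : (X × (ℝ × ℝ)) × ℝ => (p.1.1, (p.1.2, p.2)))) c

theorem sq_intervalIntegral_le {a x y : ℝ} (hx : x ∈ Icc 0 a) (hy : y ∈ Icc 0 a) {f : ℝ → ℝ}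
    (hf : Continuous f) : (∫ s in y..x, f s) ^ 2 ≤ a * ∫ s, f s ^ 2 ∂cellMeasure a := by
  have ha : 0 ≤ a := hx.1.trans hx.2
  set m := ∫ s, |f s| ∂cellMeasure a with hm
  have habs : |∫ s in y..x, f s| ≤ m := by
    have h1 := intervalIntegral.norm_integral_le_integral_norm_uIoc (f := f) (a := y) (b := x)
      (μ := volume)
    refine h1.trans ?_
    refine setIntegral_mono_set (hf.abs.integrable_cell a)
      (Eventually.of_forall fun s => abs_nonneg _) (Eventually.of_forall ?_)
    intro s hs
    change min y x < s ∧ s ≤ max y x at hs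
    exact ⟨lt_of_le_of_lt (le_min hy.1 hx.1) hs.1, hs.2.trans (max_le hy.2 hx.2)⟩
  have hsq : m ^ 2 ≤ a * ∫ s, f s ^ 2 ∂cellMeasure a := by
    have h0 : 0 ≤ ∫ s, (a * |f s| - m) ^ 2 ∂cellMeasure a := integral_nonneg fun s => sq_nonneg _
    have h1 : ∫ s, (a * |f s| - m) ^ 2 ∂cellMeasure a
        = a ^ 2 * ∫ s, f s ^ 2 ∂cellMeasure a - 2 * a * m * m + a * m ^ 2 := by
      have : ∀ s, (a * |f s| - m) ^ 2 = a ^ 2 * f s ^ 2 - 2 * a * m * |f s| + m ^ 2 := fun s => by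
        rw [← sq_abs (f s)]; ring
      simp only [this]
      rw [integral_add, integral_sub, integral_const_mul, integral_const_mul,
        integral_cell_const ha]
      all_goals exact Continuous.integrable_cell (by fun_prop) a
    rcases ha.eq_or_lt with rfl | ha'
    · simp [hm, cellMeasure]
    · rw [h1] at h0
      have : 0 ≤ a * (a * ∫ s, f s ^ 2 ∂cellMeasure a - m ^ 2) := by nlinarith
      linarith [nonneg_of_mul_nonneg_right this ha']
  calc (∫ s in y..x, f s) ^ 2 = |∫ s in y..x, f s| ^ 2 := (sq_abs _).symm
    _ ≤ m ^ 2 := by gcongr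
    _ ≤ _ := hsq

theorem sq_sub_le_integral_deriv_sq {a x y : ℝ} (hx : x ∈ Icc 0 a) (hy : y ∈ Icc 0 a)
    {f f' : ℝ → ℝ} (hd : ∀ s, HasDerivAt f (f' s) s) (hf' : Continuous f') :
    (f x - f y) ^ 2 ≤ a * ∫ s, f' s ^ 2 ∂cellMeasure a := by
  rw [← intervalIntegral.integral_eq_sub_of_hasDerivAt (fun s _ => hd s)
    (hf'.intervalIntegrable _ _)]
  exact sq_intervalIntegral_le hx hy hf'

/-- **Poincaré inequality** on a square, for functions of mean zero. -/
theorem poincare_square {a : ℝ} (ha : 0 < a) {H H₁ H₂ : ℝ × ℝ → ℝ} (hH : Continuous H)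
    (hH₁ : Continuous H₁) (hH₂ : Continuous H₂)
    (hd₁ : ∀ x y, HasDerivAt (fun s => H (s, y)) (H₁ (x, y)) x)
    (hd₂ : ∀ x y, HasDerivAt (fun s => H (x, s)) (H₂ (x, y)) y)
    (hmean : ∫ p, H p ∂squareMeasure a = 0) :
    ∫ p, H p ^ 2 ∂squareMeasure a
      ≤ 2 * a ^ 2 * (∫ p, H₁ p ^ 2 ∂squareMeasure a + ∫ p, H₂ p ^ 2 ∂squareMeasure a) := by
  set P : ℝ → ℝ := fun y => ∫ s, H₁ (s, y) ^ 2 ∂cellMeasure a with hP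
  set R : ℝ → ℝ := fun x => ∫ s, H₂ (x, s) ^ 2 ∂cellMeasure a with hR
  have hPc : Continuous P :=
    Continuous.integral_cell (f := fun y s => H₁ (s, y) ^ 2)
      (by unfold Function.uncurry; fun_prop) a
  have hRc : Continuous R :=
    Continuous.integral_cell (f := fun y s => H₂ (y, s) ^ 2)
      (by unfold Function.uncurry; fun_prop) a
  have hPint : ∫ y, P y ∂cellMeasure a = ∫ p, H₁ p ^ 2 ∂squareMeasure a :=
    (integral_square_symm (hH₁.pow 2) a).symm
  have hRint : ∫ x, R x ∂cellMeasure a = ∫ p, H₂ p ^ 2 ∂squareMeasure a :=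
    (integral_square (hH₂.pow 2) a).symm
  have hconst (C : ℝ) : ∫ _, C ∂squareMeasure a = a ^ 2 * C := by
    rw [integral_square continuous_const]; simp only [integral_cell_const ha.le]; ring
  have key : ∀ᵐ x ∂cellMeasure a, ∫ p, H p ^ 2 ∂squareMeasure a
      ≤ 2 * a ^ 2 * ∫ p, H₁ p ^ 2 ∂squareMeasure a + 2 * a ^ 3 * R x := by
    filter_upwards [ae_mem_cell a] with x' hx'
    have h0 : (0 : ℝ) ∈ Icc 0 a := ⟨le_rfl, ha.le⟩
    set h := H (x', 0)
    have e1 : ∫ p, (H p - h) ^ 2 ∂squareMeasure a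
        = ∫ p, H p ^ 2 ∂squareMeasure a + a ^ 2 * h ^ 2 := by
      have : ∀ p, (H p - h) ^ 2 = H p ^ 2 - 2 * h * H p + h ^ 2 := fun p => by ring
      simp only [this]
      rw [integral_add, integral_sub, integral_const_mul, hmean, hconst]
      · ring
      all_goals exact Continuous.integrable_square (by fun_prop) a
    have e2 : ∫ p, (H p - h) ^ 2 ∂squareMeasure a
        ≤ ∫ p, (2 * a * P p.2 + 2 * a * R x') ∂squareMeasure a := by
      refine integral_mono_ae (Continuous.integrable_square (by fun_prop) a)
        (Continuous.integrable_square (by fun_prop) a) ?_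
      filter_upwards [ae_mem_square a] with p hp
      have i1 := sq_sub_le_integral_deriv_sq hp.1 hx' (f' := fun s => H₁ (s, p.2))
        (fun s => hd₁ s p.2) (by fun_prop)
      have i2 := sq_sub_le_integral_deriv_sq hp.2 h0 (f' := fun s => H₂ (x', s)) (fun s => hd₂ x' s)
        (by fun_prop)
      change (H (p.1, p.2) - _) ^ 2 ≤ _
      simp only [hP, hR, h]
      nlinarith [sq_nonneg ((H (p.1, p.2) - H (x', p.2)) - (H (x', p.2) - H (x', 0)))]
    have e3 : ∫ p, (2 * a * P p.2 + 2 * a * R x') ∂squareMeasure a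
        = 2 * a ^ 2 * ∫ p, H₁ p ^ 2 ∂squareMeasure a + 2 * a ^ 3 * R x' := by
      rw [integral_square (by fun_prop)]
      have : ∫ y, (2 * a * P y + 2 * a * R x') ∂cellMeasure a
          = 2 * a * ∫ p, H₁ p ^ 2 ∂squareMeasure a + a * (2 * a * R x') := by
        rw [integral_add, integral_const_mul, integral_cell_const ha.le, hPint]
        all_goals exact Continuous.integrable_cell (by fun_prop) a
      simp only [this, integral_cell_const ha.le]
      ring
    nlinarith [mul_nonneg (sq_nonneg a) (sq_nonneg h)]
  have := integral_mono_ae (integrable_const _) (Continuous.integrable_cell (by fun_prop) a) key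
  rw [integral_cell_const ha.le, integral_add (integrable_const _)
    (Continuous.integrable_cell (by fun_prop) a), integral_cell_const ha.le, integral_const_mul,
    hRint] at this
  have h2 : 0 ≤ a * (2 * a ^ 2 * (∫ p, H₁ p ^ 2 ∂squareMeasure a + ∫ p, H₂ p ^ 2 ∂squareMeasure a)
    - ∫ p, H p ^ 2 ∂squareMeasure a) := by nlinarith
  linarith [nonneg_of_mul_nonneg_right h2 ha]

/-- The derivative of `g` in the direction `e`. -/
def dirDeriv (e : (ℝ × ℝ) × ℝ) (g : (ℝ × ℝ) × ℝ → ℝ) : (ℝ × ℝ) × ℝ → ℝ := fun p => fderiv ℝ g p e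

/-- The unit vector in the `x` direction. -/
abbrev ex : (ℝ × ℝ) × ℝ := ((1, 0), 0)

/-- The unit vector in the `y` direction. -/
abbrev ey : (ℝ × ℝ) × ℝ := ((0, 1), 0)

/-- The unit vector in the `z` direction. -/
abbrev ez : (ℝ × ℝ) × ℝ := ((0, 0), 1)

/-- Smooth functions on `ℝ³` with period `a` in `x` and `y` and period `c` in `z`. -/
structure SmoothPeriodic (a c : ℝ) (g : (ℝ × ℝ) × ℝ → ℝ) : Prop where
  contDiff : ContDiff ℝ (⊤ : ℕ∞) g
  periodic_x : ∀ p, g (p + ((a, 0), 0)) = g p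
  periodic_y : ∀ p, g (p + ((0, a), 0)) = g p
  periodic_z : ∀ p, g (p + ((0, 0), c)) = g p

section DirDeriv

variable {g h : (ℝ × ℝ) × ℝ → ℝ}

theorem dirDeriv_mul (hg : ContDiff ℝ (⊤ : ℕ∞) g) (hh : ContDiff ℝ (⊤ : ℕ∞) h) (e p : (ℝ × ℝ) × ℝ) :
    dirDeriv e (fun q => g q * h q) p = dirDeriv e g p * h p + g p * dirDeriv e h p := by
  unfold dirDeriv
  rw [fderiv_fun_mul (hg.differentiable (by simp) p) (hh.differentiable (by simp) p)]
  simp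
  ring

theorem dirDeriv_sub (hg : ContDiff ℝ (⊤ : ℕ∞) g) (hh : ContDiff ℝ (⊤ : ℕ∞) h) (e : (ℝ × ℝ) × ℝ) :
    dirDeriv e (fun q => g q - h q) = fun p => dirDeriv e g p - dirDeriv e h p := by
  ext p
  unfold dirDeriv
  rw [fderiv_fun_sub (hg.differentiable (by simp) p) (hh.differentiable (by simp) p)]
  simp

theorem contDiff_dirDeriv (hg : ContDiff ℝ (⊤ : ℕ∞) g) (e : (ℝ × ℝ) × ℝ) :
    ContDiff ℝ (⊤ : ℕ∞) (dirDeriv e g) :=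
  (hg.fderiv_right (by simp)).clm_apply contDiff_const

theorem hasDerivAt_x (hg : ContDiff ℝ (⊤ : ℕ∞) g) (x y z : ℝ) :
    HasDerivAt (fun s => g ((s, y), z)) (dirDeriv ex g ((x, y), z)) x :=
  (hg.differentiable (by simp) ((x, y), z)).hasFDerivAt.comp_hasDerivAt x
    (((hasDerivAt_id x).prodMk (hasDerivAt_const x y)).prodMk (hasDerivAt_const x z))

theorem hasDerivAt_y (hg : ContDiff ℝ (⊤ : ℕ∞) g) (x y z : ℝ) :
    HasDerivAt (fun s => g ((x, s), z)) (dirDeriv ey g ((x, y), z)) y :=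
  (hg.differentiable (by simp) ((x, y), z)).hasFDerivAt.comp_hasDerivAt y
    (((hasDerivAt_const y x).prodMk (hasDerivAt_id y)).prodMk (hasDerivAt_const y z))

theorem hasDerivAt_z (hg : ContDiff ℝ (⊤ : ℕ∞) g) (q : ℝ × ℝ) (z : ℝ) :
    HasDerivAt (fun s => g (q, s)) (dirDeriv ez g (q, z)) z :=
  (hg.differentiable (by simp) (q, z)).hasFDerivAt.comp_hasDerivAt z
    ((hasDerivAt_const z q).prodMk (hasDerivAt_id z))

end DirDeriv

namespace SmoothPeriodic

variable {a c : ℝ} {g h : (ℝ × ℝ) × ℝ → ℝ}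

protected theorem continuous (hg : SmoothPeriodic a c g) : Continuous g := hg.contDiff.continuous

protected theorem mul (hg : SmoothPeriodic a c g) (hh : SmoothPeriodic a c h) :
    SmoothPeriodic a c (fun p => g p * h p) where
  contDiff := hg.contDiff.mul hh.contDiff
  periodic_x p := by rw [hg.periodic_x, hh.periodic_x]
  periodic_y p := by rw [hg.periodic_y, hh.periodic_y]
  periodic_z p := by rw [hg.periodic_z, hh.periodic_z]

protected theorem sub (hg : SmoothPeriodic a c g) (hh : SmoothPeriodic a c h) :
    SmoothPeriodic a c (fun p => g p - h p) where
  contDiff := hg.contDiff.sub hh.contDiff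
  periodic_x p := by rw [hg.periodic_x, hh.periodic_x]
  periodic_y p := by rw [hg.periodic_y, hh.periodic_y]
  periodic_z p := by rw [hg.periodic_z, hh.periodic_z]

protected theorem dirDeriv (hg : SmoothPeriodic a c g) (e : (ℝ × ℝ) × ℝ) :
    SmoothPeriodic a c (dirDeriv e g) where
  contDiff := contDiff_dirDeriv hg.contDiff e
  periodic_x p := by
    unfold dirDeriv
    rw [← fderiv_comp_add_right, funext hg.periodic_x]
  periodic_y p := by
    unfold dirDeriv
    rw [← fderiv_comp_add_right, funext hg.periodic_y]
  periodic_z p := by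
    unfold dirDeriv
    rw [← fderiv_comp_add_right, funext hg.periodic_z]

theorem integral_dirDeriv_ex (ha : 0 ≤ a) (hg : SmoothPeriodic a c g) :
    ∫ p, dirDeriv ex g p ∂boxMeasure a c = 0 := by
  have hc := (hg.dirDeriv ex).continuous
  have h0 (y z : ℝ) : ∫ x, dirDeriv ex g ((x, y), z) ∂cellMeasure a = 0 := by
    rw [integral_cell ha, intervalIntegral.integral_eq_sub_of_hasDerivAt
      (fun s _ => hasDerivAt_x hg.contDiff s y z)
      (Continuous.intervalIntegrable (by fun_prop) _ _), sub_eq_zero]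
    simpa using hg.periodic_x ((0, y), z)
  rw [integral_box_symm hc]
  have h1 (z : ℝ) : ∫ q, dirDeriv ex g (q, z) ∂squareMeasure a = 0 := by
    rw [integral_square_symm (by fun_prop)]
    simp [h0]
  simp [h1]

theorem integral_dirDeriv_ey (ha : 0 ≤ a) (hg : SmoothPeriodic a c g) :
    ∫ p, dirDeriv ey g p ∂boxMeasure a c = 0 := by
  have hc := (hg.dirDeriv ey).continuous
  have h0 (x z : ℝ) : ∫ y, dirDeriv ey g ((x, y), z) ∂cellMeasure a = 0 := by
    rw [integral_cell ha, intervalIntegral.integral_eq_sub_of_hasDerivAt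
      (fun s _ => hasDerivAt_y hg.contDiff x s z)
      (Continuous.intervalIntegrable (by fun_prop) _ _), sub_eq_zero]
    simpa using hg.periodic_y ((x, 0), z)
  rw [integral_box_symm hc]
  have h1 (z : ℝ) : ∫ q, dirDeriv ey g (q, z) ∂squareMeasure a = 0 := by
    rw [integral_square (by fun_prop)]
    simp [h0]
  simp [h1]

theorem integral_dirDeriv_ez (hc : 0 ≤ c) (hg : SmoothPeriodic a c g) :
    ∫ p, dirDeriv ez g p ∂boxMeasure a c = 0 := by
  have hcont := (hg.dirDeriv ez).continuous
  have h0 (q : ℝ × ℝ) : ∫ z, dirDeriv ez g (q, z) ∂cellMeasure c = 0 := by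
    rw [integral_cell hc, intervalIntegral.integral_eq_sub_of_hasDerivAt
      (fun s _ => hasDerivAt_z hg.contDiff q s)
      (Continuous.intervalIntegrable (by fun_prop) _ _), sub_eq_zero]
    have hq : (q, (0 : ℝ)) + ((0, 0), c) = (q, c) := by ext <;> simp
    rw [← hq, hg.periodic_z]
  rw [integral_box hcont]
  simp [h0]

theorem integral_by_parts {e : (ℝ × ℝ) × ℝ}
    (he : ∀ f, SmoothPeriodic a c f → ∫ p, dirDeriv e f p ∂boxMeasure a c = 0)
    (hg : SmoothPeriodic a c g) (hh : SmoothPeriodic a c h) :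
    ∫ p, dirDeriv e g p * h p ∂boxMeasure a c
      = -∫ p, g p * dirDeriv e h p ∂boxMeasure a c := by
  have hg' := (hg.dirDeriv e).continuous
  have hh' := (hh.dirDeriv e).continuous
  have hgc := hg.continuous
  have hhc := hh.continuous
  have := he _ (hg.mul hh)
  simp only [dirDeriv_mul hg.contDiff hh.contDiff] at this
  rw [integral_add (Continuous.integrable_box (by fun_prop) a c)
    (Continuous.integrable_box (by fun_prop) a c)] at this
  linarith

/-- **Poincaré inequality** for periodic functions of vanishing horizontal mean. -/
theorem poincare (ha : 0 < a) (hg : SmoothPeriodic a c g)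
    (hmean : ∀ z, ∫ q, g (q, z) ∂squareMeasure a = 0) :
    ∫ p, g p ^ 2 ∂boxMeasure a c ≤ 2 * a ^ 2 *
      (∫ p, dirDeriv ex g p ^ 2 ∂boxMeasure a c
        + ∫ p, dirDeriv ey g p ^ 2 ∂boxMeasure a c) := by
  have hgc := hg.continuous
  have hx := (hg.dirDeriv ex).continuous
  have hy := (hg.dirDeriv ey).continuous
  have hi {f : (ℝ × ℝ) × ℝ → ℝ} (hf : Continuous f) :
      Integrable (fun z => ∫ q, f (q, z) ^ 2 ∂squareMeasure a) (cellMeasure c) :=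
    Continuous.integrable_cell (Continuous.integral_square (f := fun z q => f (q, z) ^ 2)
      (by unfold Function.uncurry; fun_prop) a) c
  rw [integral_box_symm (by fun_prop), integral_box_symm (by fun_prop),
    integral_box_symm (by fun_prop), ← integral_add (hi hx) (hi hy), ← integral_const_mul]
  refine integral_mono (hi hgc) (((hi hx).add (hi hy)).const_mul _) fun z => ?_
  exact poincare_square ha (H := fun q => g (q, z)) (H₁ := fun q => dirDeriv ex g (q, z))
    (H₂ := fun q => dirDeriv ey g (q, z)) (by fun_prop) (by fun_prop) (by fun_prop)
    (fun x y => hasDerivAt_x hg.contDiff x y z) (fun x y => hasDerivAt_y hg.contDiff x y z)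
    (hmean z)

end SmoothPeriodic

theorem integral_mul_le {a c ε : ℝ} (hε : 0 < ε) {f g : (ℝ × ℝ) × ℝ → ℝ} (hf : Continuous f)
    (hg : Continuous g) : ∫ p, f p * g p ∂boxMeasure a c
      ≤ ε / 2 * ∫ p, f p ^ 2 ∂boxMeasure a c + 1 / (2 * ε) * ∫ p, g p ^ 2 ∂boxMeasure a c := by
  rw [← integral_const_mul, ← integral_const_mul, ← integral_add]
  · refine integral_mono (Continuous.integrable_box (by fun_prop) a c)
      (Continuous.integrable_box (by fun_prop) a c) fun p => ?_
    have : ε / 2 * f p ^ 2 + 1 / (2 * ε) * g p ^ 2 - f p * g p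
        = (ε * f p - g p) ^ 2 / (2 * ε) := by field_simp; ring
    have h2 : 0 ≤ (ε * f p - g p) ^ 2 / (2 * ε) := by positivity
    change f p * g p ≤ ε / 2 * f p ^ 2 + 1 / (2 * ε) * g p ^ 2
    linarith
  all_goals exact Continuous.integrable_box (by fun_prop) a c

namespace SmoothPeriodic

variable {a c : ℝ}

theorem integral_mul_laplacian (ha : 0 ≤ a) {f g : (ℝ × ℝ) × ℝ → ℝ} (hf : SmoothPeriodic a c f)
    (hg : SmoothPeriodic a c g) :
    ∫ p, f p * (dirDeriv ex (dirDeriv ex g) p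
        + dirDeriv ey (dirDeriv ey g) p) ∂boxMeasure a c
      = -(∫ p, dirDeriv ex f p * dirDeriv ex g p ∂boxMeasure a c
        + ∫ p, dirDeriv ey f p * dirDeriv ey g p ∂boxMeasure a c) := by
  have hfc := hf.continuous
  have hx := ((hg.dirDeriv ex).dirDeriv ex).continuous
  have hy := ((hg.dirDeriv ey).dirDeriv ey).continuous
  simp only [mul_add]
  rw [integral_add (Continuous.integrable_box (by fun_prop) a c)
    (Continuous.integrable_box (by fun_prop) a c),
    integral_by_parts (fun _ h => h.integral_dirDeriv_ex ha) hf (hg.dirDeriv ex),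
    integral_by_parts (fun _ h => h.integral_dirDeriv_ey ha) hf (hg.dirDeriv ey)]
  ring

/-- The diagnostic equations control the velocity by the temperature in `L²`. -/
theorem velocity_estimate (ha : 0 < a) (hc : 0 ≤ c) (Ra : ℝ) {θ w ω ψ : (ℝ × ℝ) × ℝ → ℝ}
    (hθ : SmoothPeriodic a c θ) (hw : SmoothPeriodic a c w) (hω : SmoothPeriodic a c ω)
    (hψ : SmoothPeriodic a c ψ)
    (eq_psi : ∀ p, dirDeriv ez ψ p = Ra * θ p
      + (dirDeriv ex (dirDeriv ex w) p + dirDeriv ey (dirDeriv ey w) p))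
    (eq_w : ∀ p, -dirDeriv ez w p
      = dirDeriv ex (dirDeriv ex ω) p + dirDeriv ey (dirDeriv ey ω) p)
    (eq_ω : ∀ p, dirDeriv ex (dirDeriv ex ψ) p
      + dirDeriv ey (dirDeriv ey ψ) p = ω p)
    (mean_w : ∀ z, ∫ q, w (q, z) ∂squareMeasure a = 0)
    (mean_ψ : ∀ z, ∫ q, ψ (q, z) ∂squareMeasure a = 0) :
    ∫ p, w p ^ 2 ∂boxMeasure a c ≤ 4 * a ^ 4 * Ra ^ 2 * ∫ p, θ p ^ 2 ∂boxMeasure a c ∧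
    ∫ p, dirDeriv ex ψ p ^ 2 ∂boxMeasure a c
        + ∫ p, dirDeriv ey ψ p ^ 2 ∂boxMeasure a c
      ≤ 2 * a ^ 4 * Ra ^ 2 * ∫ p, θ p ^ 2 ∂boxMeasure a c := by
  have hθc := hθ.continuous
  have hwc := hw.continuous
  have hωc := hω.continuous
  have hψc := hψ.continuous
  have hwL := integral_mul_laplacian ha.le hw hw
  have hψL := integral_mul_laplacian ha.le hψ hψ
  have hψω := integral_mul_laplacian ha.le hψ hω
  have hωψ := integral_mul_laplacian ha.le hω hψ
  simp only [eq_ω] at hψL hωψ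
  simp only [← eq_w] at hψω
  have hibp := integral_by_parts (fun _ h => h.integral_dirDeriv_ez hc) hψ hw
  have hbal : ∫ p, dirDeriv ez ψ p * w p ∂boxMeasure a c
      = Ra * ∫ p, θ p * w p ∂boxMeasure a c
        + ∫ p, w p * (dirDeriv ex (dirDeriv ex w) p
          + dirDeriv ey (dirDeriv ey w) p) ∂boxMeasure a c := by
    have hx := ((hw.dirDeriv ex).dirDeriv ex).continuous
    have hy := ((hw.dirDeriv ey).dirDeriv ey).continuous
    rw [← integral_const_mul, ← integral_add (Continuous.integrable_box (by fun_prop) a c)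
      (Continuous.integrable_box (by fun_prop) a c)]
    congr 1 with p
    rw [eq_psi]; ring
  have hcomm (e : (ℝ × ℝ) × ℝ) : ∫ p, dirDeriv e ψ p * dirDeriv e ω p ∂boxMeasure a c
      = ∫ p, dirDeriv e ω p * dirDeriv e ψ p ∂boxMeasure a c := by
    simp only [mul_comm]
  rw [hcomm, hcomm] at hψω
  have hneg : ∫ p, ψ p * -dirDeriv ez w p ∂boxMeasure a c
      = -∫ p, ψ p * dirDeriv ez w p ∂boxMeasure a c := by
    simp only [mul_neg, integral_neg]
  have hpw := hw.poincare ha mean_w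
  have hpψ := hψ.poincare ha mean_ψ
  have hA : 0 < 2 * a ^ 2 := by positivity
  have hy1 := integral_mul_le (a := a) (c := c) hA (f := fun p => Ra * θ p) (by fun_prop) hwc
  have hy2 := integral_mul_le (a := a) (c := c) hA (f := fun p => -ω p) (by fun_prop) hψc
  have e1 : ∫ p, Ra * θ p * w p ∂boxMeasure a c = Ra * ∫ p, θ p * w p ∂boxMeasure a c := by
    simp only [mul_assoc, integral_const_mul]
  have e2 : ∫ p, -ω p * ψ p ∂boxMeasure a c = - ∫ p, ψ p * ω p ∂boxMeasure a c := by
    rw [← integral_neg]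
    congr 1 with p
    ring
  have e3 : ∫ p, (Ra * θ p) ^ 2 ∂boxMeasure a c = Ra ^ 2 * ∫ p, θ p ^ 2 ∂boxMeasure a c := by
    simp only [mul_pow, integral_const_mul]
  rw [e1, e3] at hy1
  simp only [neg_sq] at hy2
  rw [e2] at hy2
  simp only [← sq] at hwL hψL hωψ
  have hω0 : 0 ≤ ∫ p, ω p ^ 2 ∂boxMeasure a c := integral_nonneg fun p => sq_nonneg _
  generalize (∫ p, ω p ^ 2 ∂boxMeasure a c) = Iω at *
  generalize (∫ p, θ p ^ 2 ∂boxMeasure a c) = Iθ at *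
  set Gw := ∫ p, dirDeriv ex w p ^ 2 ∂boxMeasure a c
    + ∫ p, dirDeriv ey w p ^ 2 ∂boxMeasure a c
  set Gψ := ∫ p, dirDeriv ex ψ p ^ 2 ∂boxMeasure a c
    + ∫ p, dirDeriv ey ψ p ^ 2 ∂boxMeasure a c
  have hhalf {I G : ℝ} (h : I ≤ 2 * a ^ 2 * G) : 1 / (2 * (2 * a ^ 2)) * I ≤ G / 2 := by
    calc 1 / (2 * (2 * a ^ 2)) * I ≤ 1 / (2 * (2 * a ^ 2)) * (2 * a ^ 2 * G) := by gcongr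
      _ = G / 2 := by field_simp
  have h1 := hhalf hpw
  have h2 := hhalf hpψ
  have hsum : Gw + Iω ≤ a ^ 2 * (Ra ^ 2 * Iθ) + Gw / 2 := by linarith
  have hG : 0 ≤ Gw := add_nonneg (integral_nonneg fun p => sq_nonneg _)
    (integral_nonneg fun p => sq_nonneg _)
  have hψ' : Gψ ≤ 2 * a ^ 2 * Iω := by linarith
  constructor
  · calc _ ≤ 2 * a ^ 2 * Gw := hpw
      _ ≤ 2 * a ^ 2 * (2 * (a ^ 2 * (Ra ^ 2 * Iθ))) := by gcongr; linarith
      _ = _ := by ring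
  · calc _ ≤ 2 * a ^ 2 * Iω := hψ'
      _ ≤ 2 * a ^ 2 * (a ^ 2 * (Ra ^ 2 * Iθ)) := by gcongr; linarith
      _ = _ := by ring

/-- The energy estimate for the heat equation of the difference of two solutions. -/
theorem energy_estimate (ha : 0 ≤ a) {C : ℝ}
    {θ θt U V u v w W X Y β B : (ℝ × ℝ) × ℝ → ℝ}
    (hθ : SmoothPeriodic a c θ) (hU : SmoothPeriodic a c U) (hV : SmoothPeriodic a c V)
    (hu : Continuous u) (hv : Continuous v) (hw : Continuous w) (hW : Continuous W)
    (hX : Continuous X) (hY : Continuous Y) (hβ : Continuous β) (hB : Continuous B)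
    (hdiv : ∀ p, dirDeriv ex U p + dirDeriv ey V p = 0)
    (heat : ∀ p, θt p = (dirDeriv ex (dirDeriv ex θ) p
        + dirDeriv ey (dirDeriv ey θ) p)
      - (U p * dirDeriv ex θ p + V p * dirDeriv ey θ p)
      - (u p * X p + v p * Y p + W p * β p + w p * B p))
    (bound : ∀ p ∈ (Icc 0 a ×ˢ Icc 0 a) ×ˢ Icc 0 c, |X p| ≤ C ∧ |Y p| ≤ C ∧ |W p| ≤ C ∧ |B p| ≤ C) :
    ∫ p, 2 * θ p * θt p ∂boxMeasure a c ≤ C * (4 * ∫ p, θ p ^ 2 ∂boxMeasure a c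
      + ∫ p, u p ^ 2 ∂boxMeasure a c + ∫ p, v p ^ 2 ∂boxMeasure a c
      + ∫ p, β p ^ 2 ∂boxMeasure a c + ∫ p, w p ^ 2 ∂boxMeasure a c) := by
  have hθc := hθ.continuous
  have hUc := hU.continuous
  have hVc := hV.continuous
  have hx := (hθ.dirDeriv ex).continuous
  have hy := (hθ.dirDeriv ey).continuous
  have hxx := ((hθ.dirDeriv ex).dirDeriv ex).continuous
  have hyy := ((hθ.dirDeriv ey).dirDeriv ey).continuous
  have hUx := (hU.dirDeriv ex).continuous
  have hVy := (hV.dirDeriv ey).continuous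
  have hlap := integral_mul_laplacian ha hθ hθ
  have hadv : ∫ p, 2 * θ p * (U p * dirDeriv ex θ p + V p * dirDeriv ey θ p)
      ∂boxMeasure a c = 0 := by
    have h1 := integral_by_parts (fun _ h => h.integral_dirDeriv_ex ha) hU (hθ.mul hθ)
    have h2 := integral_by_parts (fun _ h => h.integral_dirDeriv_ey ha) hV (hθ.mul hθ)
    simp only [dirDeriv_mul hθ.contDiff hθ.contDiff] at h1 h2
    have h3 : ∫ p, dirDeriv ex U p * (θ p * θ p) ∂boxMeasure a c
        + ∫ p, dirDeriv ey V p * (θ p * θ p) ∂boxMeasure a c = 0 := by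
      rw [← integral_add (Continuous.integrable_box (by fun_prop) a c)
        (Continuous.integrable_box (by fun_prop) a c)]
      simp [← add_mul, hdiv]
    rw [h1, h2, ← neg_add, neg_eq_zero,
      ← integral_add (Continuous.integrable_box (by fun_prop) a c)
        (Continuous.integrable_box (by fun_prop) a c)] at h3
    rw [← h3]
    congr 1 with p
    ring
  have hrest : ∫ p, -(2 * θ p * (u p * X p + v p * Y p + W p * β p + w p * B p)) ∂boxMeasure a c
      ≤ ∫ p, C * (4 * θ p ^ 2 + u p ^ 2 + v p ^ 2 + β p ^ 2 + w p ^ 2) ∂boxMeasure a c := by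
    refine integral_mono_ae (Continuous.integrable_box (by fun_prop) a c)
      (Continuous.integrable_box (by fun_prop) a c) ?_
    filter_upwards [ae_mem_box a c] with p hp
    obtain ⟨h1, h2, h3, h4⟩ := bound p hp
    have young {r s k : ℝ} (hk : |k| ≤ C) : -(2 * r * (s * k)) ≤ C * (r ^ 2 + s ^ 2) := by
      have i1 := abs_le.mp hk
      nlinarith [mul_nonneg (sub_nonneg.2 i1.2) (sq_nonneg (r - s)),
        mul_nonneg (by linarith : 0 ≤ C + k) (sq_nonneg (r + s)), sq_nonneg (r - s),
        sq_nonneg (r + s)]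
    have j1 := young (r := θ p) (s := u p) h1
    have j2 := young (r := θ p) (s := v p) h2
    have j3 := young (r := θ p) (s := β p) h3
    have j4 := young (r := θ p) (s := w p) h4
    nlinarith
  have hsplit : ∫ p, 2 * θ p * θt p ∂boxMeasure a c
      = 2 * ∫ p, θ p * (dirDeriv ex (dirDeriv ex θ) p
          + dirDeriv ey (dirDeriv ey θ) p) ∂boxMeasure a c
        - ∫ p, 2 * θ p * (U p * dirDeriv ex θ p + V p * dirDeriv ey θ p)
          ∂boxMeasure a c
        + ∫ p, -(2 * θ p * (u p * X p + v p * Y p + W p * β p + w p * B p)) ∂boxMeasure a c := by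
    rw [← integral_const_mul, ← integral_sub, ← integral_add]
    · congr 1 with p
      rw [heat]; ring
    all_goals exact Continuous.integrable_box (by fun_prop) a c
  have hexp : ∫ p, C * (4 * θ p ^ 2 + u p ^ 2 + v p ^ 2 + β p ^ 2 + w p ^ 2) ∂boxMeasure a c
      = C * (4 * ∫ p, θ p ^ 2 ∂boxMeasure a c
      + ∫ p, u p ^ 2 ∂boxMeasure a c + ∫ p, v p ^ 2 ∂boxMeasure a c
      + ∫ p, β p ^ 2 ∂boxMeasure a c + ∫ p, w p ^ 2 ∂boxMeasure a c) := by
    rw [integral_const_mul, integral_add, integral_add, integral_add, integral_add,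
      integral_const_mul]
    all_goals exact Continuous.integrable_box (by fun_prop) a c
  have hxn : 0 ≤ ∫ p, dirDeriv ex θ p * dirDeriv ex θ p ∂boxMeasure a c :=
    integral_nonneg fun p => mul_self_nonneg _
  have hyn : 0 ≤ ∫ p, dirDeriv ey θ p * dirDeriv ey θ p ∂boxMeasure a c :=
    integral_nonneg fun p => mul_self_nonneg _
  linarith

end SmoothPeriodic

/-- A mean profile gradient `β` that differs by a constant from the horizontal mean of `G` is
bounded by `G` in `L²`. -/
theorem profile_estimate {a c k : ℝ} {β : ℝ → ℝ} {G : (ℝ × ℝ) × ℝ → ℝ}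
    (hβ : Continuous β) (hG : Continuous G) (mean_β : ∫ z, β z ∂cellMeasure c = 0)
    (hk : ∀ z, ∫ q, (β z - G (q, z)) ∂squareMeasure a = k) :
    ∫ p, β p.2 ^ 2 ∂boxMeasure a c ≤ ∫ p, G p ^ 2 ∂boxMeasure a c := by
  have h0 : ∫ p, β p.2 * (β p.2 - G p) ∂boxMeasure a c = 0 := by
    rw [integral_box_symm (by fun_prop)]
    simp only [integral_const_mul, hk, integral_mul_const, mean_β, zero_mul]
  have h1 : ∫ p, β p.2 * (β p.2 - G p) ∂boxMeasure a c
      = ∫ p, β p.2 ^ 2 ∂boxMeasure a c - ∫ p, β p.2 * G p ∂boxMeasure a c := by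
    rw [← integral_sub (Continuous.integrable_box (by fun_prop) a c)
      (Continuous.integrable_box (by fun_prop) a c)]
    congr 1 with p
    ring
  have h2 := integral_mul_le (a := a) (c := c) one_pos (f := fun p => β p.2) (by fun_prop) hG
  linarith

theorem SmoothPeriodic.eq_zero_of_integral_sq_nonpos {a c : ℝ} (ha : 0 < a) (hc : 0 < c)
    {g : (ℝ × ℝ) × ℝ → ℝ} (hg : SmoothPeriodic a c g)
    (h : ∫ p, g p ^ 2 ∂boxMeasure a c ≤ 0) (p : (ℝ × ℝ) × ℝ) : g p = 0 := by
  have hgc := hg.continuous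
  have h0 : ∫ p, g p ^ 2 ∂boxMeasure a c = 0 := le_antisymm h (integral_nonneg fun p => sq_nonneg _)
  rw [integral_eq_zero_iff_of_nonneg (f := fun p => g p ^ 2) (fun p => sq_nonneg _)
    (Continuous.integrable_box (by fun_prop) a c), boxMeasure_eq_restrict] at h0
  have hbox : EqOn (fun p => g p ^ 2) 0 ((Ioc 0 a ×ˢ Ioc 0 a) ×ˢ Ioc 0 c) := by
    refine Measure.eqOn_of_ae_eq h0 (hgc.pow 2).continuousOn continuousOn_const ?_
    simp only [interior_prod_eq, closure_prod_eq, interior_Ioc, closure_Ioo ha.ne,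
      closure_Ioo hc.ne]
    exact Set.prod_mono (Set.prod_mono Ioc_subset_Icc_self Ioc_subset_Icc_self) Ioc_subset_Icc_self
  obtain ⟨⟨x, y⟩, z⟩ := p
  have px' : Function.Periodic (fun s => g ((s, y), z)) a := fun s => by
    simpa using hg.periodic_x ((s, y), z)
  obtain ⟨x', hx', ex'⟩ := px'.exists_mem_Ioc ha x 0
  have py' : Function.Periodic (fun s => g ((x', s), z)) a := fun s => by
    simpa using hg.periodic_y ((x', s), z)
  obtain ⟨y', hy', ey'⟩ := py'.exists_mem_Ioc ha y 0
  have pz' : Function.Periodic (fun s => g ((x', y'), s)) c := fun s => by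
    simpa using hg.periodic_z ((x', y'), s)
  obtain ⟨z', hz', ez'⟩ := pz'.exists_mem_Ioc hc z 0
  simp only [zero_add] at hx' hy' hz'
  have := hbox (x := ((x', y'), z')) ⟨⟨hx', hy'⟩, hz'⟩
  rw [ex', ey', ez']
  simpa using this

theorem SmoothPeriodic.hasDerivAt_integral_square {a c : ℝ} {g : (ℝ × ℝ) × ℝ → ℝ}
    (hg : SmoothPeriodic a c g) (z : ℝ) :
    HasDerivAt (fun s => ∫ q, g (q, s) ∂squareMeasure a)
      (∫ q, dirDeriv ez g (q, z) ∂squareMeasure a) z := by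
  have hgc := hg.continuous
  have hz := (hg.dirDeriv ez).continuous
  obtain ⟨C, hC⟩ := ((isCompact_square a).prod
    (isCompact_closedBall z 1)).exists_bound_of_continuousOn hz.continuousOn
  exact hasDerivAt_integral_of_bounded_deriv (F := fun s q => g (q, s))
    (F' := fun s q => dirDeriv ez g (q, s)) (isCompact_square a) (ae_mem_square a)
    (Metric.closedBall_mem_nhds z one_pos) (fun t _ => by fun_prop) (by fun_prop)
    (fun t ht p hp => hC (p, t) ⟨hp, ht⟩) (fun p t _ => hasDerivAt_z hg.contDiff p t)

/-- The function of `((x, y), z)` obtained by freezing the time `t`. -/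
def slice (f : F4) (t : ℝ) : (ℝ × ℝ) × ℝ → ℝ := fun p => f p.1.1 p.1.2 p.2 t

/-- Space-time derivative of `f` in the direction `e`, one-sided in time on `ℝ³ × [0, T]`. -/
def spaceTimeDeriv (T : ℝ) (e : ℝ × ℝ × ℝ × ℝ) (f : F4) : F4 := fun x y z t =>
  fderivWithin ℝ (fun p : ℝ × ℝ × ℝ × ℝ => f p.1 p.2.1 p.2.2.1 p.2.2.2)
    {p : ℝ × ℝ × ℝ × ℝ | p.2.2.2 ∈ Icc 0 T} (x, y, z, t) e

theorem slice_px {f : F4} {t : ℝ} (hf : ContDiff ℝ (⊤ : ℕ∞) (slice f t)) :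
    slice (px f) t = dirDeriv ex (slice f t) :=
  funext fun p => (hasDerivAt_x hf p.1.1 p.1.2 p.2).deriv

theorem slice_py {f : F4} {t : ℝ} (hf : ContDiff ℝ (⊤ : ℕ∞) (slice f t)) :
    slice (py f) t = dirDeriv ey (slice f t) :=
  funext fun p => (hasDerivAt_y hf p.1.1 p.1.2 p.2).deriv

theorem slice_pz {f : F4} {t : ℝ} (hf : ContDiff ℝ (⊤ : ℕ∞) (slice f t)) :
    slice (pz f) t = dirDeriv ez (slice f t) :=
  funext fun p => (hasDerivAt_z hf p.1 p.2).deriv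

theorem slice_lapH {f : F4} {t : ℝ} (hf : ContDiff ℝ (⊤ : ℕ∞) (slice f t)) (p : (ℝ × ℝ) × ℝ) :
    slice (lapH f) t p = dirDeriv ex (dirDeriv ex (slice f t)) p
      + dirDeriv ey (dirDeriv ey (slice f t)) p := by
  have hx := slice_px hf
  have hy := slice_py hf
  have hxx := slice_px (f := px f) (t := t) (hx ▸ contDiff_dirDeriv hf ex)
  have hyy := slice_py (f := py f) (t := t) (hy ▸ contDiff_dirDeriv hf ey)
  rw [← hx, ← hy, ← hxx, ← hyy]
  rfl

namespace SmoothF4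

variable {T : ℝ} {f g : F4}

theorem uniqueDiffOn (hT : 0 < T) :
    UniqueDiffOn ℝ {p : ℝ × ℝ × ℝ × ℝ | p.2.2.2 ∈ Icc 0 T} := by
  have h : {p : ℝ × ℝ × ℝ × ℝ | p.2.2.2 ∈ Icc 0 T}
      = univ ×ˢ univ ×ˢ univ ×ˢ Icc 0 T := by ext; simp
  rw [h]
  exact uniqueDiffOn_univ.prod (uniqueDiffOn_univ.prod
    (uniqueDiffOn_univ.prod (uniqueDiffOn_Icc hT)))

protected theorem sub {D : Set ℝ} (hf : SmoothF4 f D) (hg : SmoothF4 g D) :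
    SmoothF4 (fun x y z t => f x y z t - g x y z t) D :=
  ContDiffOn.sub hf hg

protected theorem spaceTimeDeriv (hT : 0 < T) (hf : SmoothF4 f (Icc 0 T)) (e : ℝ × ℝ × ℝ × ℝ) :
    SmoothF4 (spaceTimeDeriv T e f) (Icc 0 T) :=
  (ContDiffOn.fderivWithin hf (uniqueDiffOn hT) (by simp)).clm_apply contDiffOn_const

theorem contDiff_slice {D : Set ℝ} (hf : SmoothF4 f D) {t : ℝ} (ht : t ∈ D) :
    ContDiff ℝ (⊤ : ℕ∞) (slice f t) :=
  ContDiffOn.comp_contDiff (f := fun p : (ℝ × ℝ) × ℝ => (p.1.1, p.1.2, p.2, t)) hf (by fun_prop)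
    fun _ => ht

theorem smoothPeriodic_slice {D : Set ℝ} {L : ℝ} (hf : SmoothF4 f D) (hper : PeriodicF4 L f)
    {t : ℝ} (ht : t ∈ D) : SmoothPeriodic (2 * π * L) (2 * π) (slice f t) where
  contDiff := hf.contDiff_slice ht
  periodic_x p := by simpa [slice] using hper.1 p.1.1 p.1.2 p.2 t
  periodic_y p := by simpa [slice] using hper.2.1 p.1.1 p.1.2 p.2 t
  periodic_z p := by simpa [slice] using hper.2.2 p.1.1 p.1.2 p.2 t

theorem exists_bound {K : Set ((ℝ × ℝ) × ℝ)} (hK : IsCompact K) (hf : SmoothF4 f (Icc 0 T)) :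
    ∃ C, ∀ t ∈ Icc 0 T, ∀ p ∈ K, |slice f t p| ≤ C := by
  have hc : ContinuousOn (fun p : ((ℝ × ℝ) × ℝ) × ℝ => slice f p.2 p.1) (K ×ˢ Icc 0 T) :=
    (ContDiffOn.continuousOn hf).comp
      (f := fun p : ((ℝ × ℝ) × ℝ) × ℝ => (p.1.1.1, p.1.1.2, p.1.2, p.2)) (by fun_prop)
      fun p hp => hp.2
  obtain ⟨C, hC⟩ := (hK.prod isCompact_Icc).exists_bound_of_continuousOn hc
  exact ⟨C, fun t ht p hp => hC (p, t) ⟨hp, ht⟩⟩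

theorem hasDerivAt_comp (hf : SmoothF4 f (Icc 0 T)) {γ : ℝ → ℝ × ℝ × ℝ × ℝ}
    {e : ℝ × ℝ × ℝ × ℝ} {s : ℝ} (hγ : HasDerivAt γ e s)
    (hmem : ∀ᶠ r in 𝓝 s, (γ r).2.2.2 ∈ Icc 0 T) :
    HasDerivAt (fun r => f (γ r).1 (γ r).2.1 (γ r).2.2.1 (γ r).2.2.2)
      (spaceTimeDeriv T e f (γ s).1 (γ s).2.1 (γ s).2.2.1 (γ s).2.2.2) s :=
  (ContDiffOn.differentiableOn hf (by simp) (γ s)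
    hmem.self_of_nhds).hasFDerivWithinAt.comp_hasDerivAt s hγ hmem

theorem px_eq (hf : SmoothF4 f (Icc 0 T)) (x y z : ℝ) {t : ℝ} (ht : t ∈ Icc 0 T) :
    px f x y z t = spaceTimeDeriv T (1, 0, 0, 0) f x y z t :=
  (hf.hasDerivAt_comp (γ := fun r => (r, y, z, t))
    ((hasDerivAt_id x).prodMk ((hasDerivAt_const x y).prodMk ((hasDerivAt_const x z).prodMk
      (hasDerivAt_const x t)))) (Eventually.of_forall fun _ => ht)).deriv

theorem py_eq (hf : SmoothF4 f (Icc 0 T)) (x y z : ℝ) {t : ℝ} (ht : t ∈ Icc 0 T) :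
    py f x y z t = spaceTimeDeriv T (0, 1, 0, 0) f x y z t :=
  (hf.hasDerivAt_comp (γ := fun r => (x, r, z, t))
    ((hasDerivAt_const y x).prodMk ((hasDerivAt_id y).prodMk ((hasDerivAt_const y z).prodMk
      (hasDerivAt_const y t)))) (Eventually.of_forall fun _ => ht)).deriv

theorem pz_eq (hf : SmoothF4 f (Icc 0 T)) (x y z : ℝ) {t : ℝ} (ht : t ∈ Icc 0 T) :
    pz f x y z t = spaceTimeDeriv T (0, 0, 1, 0) f x y z t :=
  (hf.hasDerivAt_comp (γ := fun r => (x, y, r, t))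
    ((hasDerivAt_const z x).prodMk ((hasDerivAt_const z y).prodMk ((hasDerivAt_id z).prodMk
      (hasDerivAt_const z t)))) (Eventually.of_forall fun _ => ht)).deriv

theorem hasDerivAt_time (hf : SmoothF4 f (Icc 0 T)) (x y z : ℝ) {t : ℝ} (ht : t ∈ Ioo 0 T) :
    HasDerivAt (fun s => f x y z s) (spaceTimeDeriv T (0, 0, 0, 1) f x y z t) t :=
  hf.hasDerivAt_comp (γ := fun r => (x, y, z, r))
    ((hasDerivAt_const t x).prodMk ((hasDerivAt_const t y).prodMk ((hasDerivAt_const t z).prodMk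
      (hasDerivAt_id t)))) (Icc_mem_nhds ht.1 ht.2)

theorem continuousOn_integral_sq (hT : 0 ≤ T) (hf : SmoothF4 f (Icc 0 T)) (a c : ℝ) :
    ContinuousOn (fun t => ∫ p, slice f t p ^ 2 ∂boxMeasure a c) (Icc 0 T) := by
  have hproj : Continuous fun p : ℝ × ((ℝ × ℝ) × ℝ) => slice f (projIcc 0 T hT p.1) p.2 := by
    refine (ContDiffOn.continuousOn hf).comp_continuous (f := fun p : ℝ × ((ℝ × ℝ) × ℝ) =>
      (p.2.1.1, p.2.1.2, p.2.2, (projIcc 0 T hT p.1 : ℝ))) ?_ fun p => (projIcc 0 T hT p.1).2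
    have := (continuous_projIcc (h := hT)).comp (continuous_fst (X := ℝ) (Y := (ℝ × ℝ) × ℝ))
    have := continuous_subtype_val.comp this
    simp only [Function.comp_def] at this
    fun_prop
  have hsq : Continuous fun p : ℝ × ((ℝ × ℝ) × ℝ) => slice f (projIcc 0 T hT p.1) p.2 ^ 2 :=
    hproj.pow 2
  refine (Continuous.integral_box (f := fun t p => slice f (projIcc 0 T hT t) p ^ 2) hsq a
    c).continuousOn.congr fun t ht => ?_
  simp only [projIcc_of_mem hT ht]

theorem hasDerivAt_integral_sq (hT : 0 < T) (hf : SmoothF4 f (Icc 0 T)) (a c : ℝ) {t : ℝ}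
    (ht : t ∈ Ioo 0 T) :
    HasDerivAt (fun t => ∫ p, slice f t p ^ 2 ∂boxMeasure a c)
      (∫ p, 2 * slice f t p * slice (spaceTimeDeriv T (0, 0, 0, 1) f) t p ∂boxMeasure a c) t := by
  have hd := hf.spaceTimeDeriv hT (0, 0, 0, 1)
  obtain ⟨C₁, hC₁⟩ := hf.exists_bound (isCompact_box a c)
  obtain ⟨C₂, hC₂⟩ := hd.exists_bound (isCompact_box a c)
  have hc {s : ℝ} (hs : s ∈ Ioo 0 T) := (hf.contDiff_slice (Ioo_subset_Icc_self hs)).continuous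
  have hdc := (hd.contDiff_slice (Ioo_subset_Icc_self ht)).continuous
  have hct := hc ht
  refine hasDerivAt_integral_of_bounded_deriv (C := 2 * C₁ * C₂) (F := fun t p => slice f t p ^ 2)
    (F' := fun t p => 2 * slice f t p * slice (spaceTimeDeriv T (0, 0, 0, 1) f) t p)
    (isCompact_box a c) (ae_mem_box a c) (Ioo_mem_nhds ht.1 ht.2) (fun s hs => (hc hs).pow 2)
    (by fun_prop) (fun s hs p hp => ?_) (fun p s hs => ?_)
  · have h1 := hC₁ s (Ioo_subset_Icc_self hs) p hp
    have h2 := hC₂ s (Ioo_subset_Icc_self hs) p hp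
    have h0 := (abs_nonneg _).trans h1
    rw [abs_mul, abs_mul, abs_two]
    gcongr
  · simpa [slice] using (hf.hasDerivAt_time p.1.1 p.1.2 p.2 hs).fun_pow 2

end SmoothF4

theorem hmean_eq {L : ℝ} (hL : 0 < L) {f : F4} {t : ℝ} (hf : Continuous (slice f t)) (z : ℝ) :
    hmean L f z t
      = (1 / (4 * π ^ 2 * L ^ 2)) * ∫ q, slice f t (q, z) ∂squareMeasure (2 * π * L) := by
  have ha : 0 ≤ 2 * π * L := by positivity
  rw [integral_square_symm (by fun_prop)]
  simp only [integral_cell ha]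
  rfl

theorem integral_eq_zero_of_hmean_eq_zero {L : ℝ} (hL : 0 < L) {f : F4} {t : ℝ}
    (hf : Continuous (slice f t)) {z : ℝ} (h : hmean L f z t = 0) :
    ∫ q, slice f t (q, z) ∂squareMeasure (2 * π * L) = 0 := by
  rw [hmean_eq hL hf] at h
  have : 1 / (4 * π ^ 2 * L ^ 2) ≠ 0 := by positivity
  exact (mul_eq_zero.mp h).resolve_left this

/-- A function of `(z, t)` seen as a function of `(x, y, z, t)`. -/
def profile (b : ℝ → ℝ → ℝ) : F4 := fun _ _ z t => b z t

theorem smoothF4_profile {b : ℝ → ℝ → ℝ} {D : Set ℝ}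
    (hb : ContDiffOn ℝ (⊤ : ℕ∞) (fun p : ℝ × ℝ => b p.1 p.2) {p : ℝ × ℝ | p.2 ∈ D}) :
    SmoothF4 (profile b) D :=
  hb.comp (f := fun p : ℝ × ℝ × ℝ × ℝ => (p.2.2.1, p.2.2.2)) (by fun_prop) fun _ hp => hp

namespace IsSolution

variable {L Ra : ℝ} {D : Set ℝ} {θ' : F4} {θb : ℝ → ℝ → ℝ} {u v w ω ψ : F4}

theorem hasDerivAt_θb (hsol : IsSolution L Ra D θ' θb u v w ω ψ) {t : ℝ} (ht : t ∈ D) (z : ℝ) :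
    HasDerivAt (fun s => θb s t) (deriv (fun s => θb s t) z) z :=
  (hasDerivAt_z ((smoothF4_profile hsol.smooth_θb).contDiff_slice ht) (0, 0) z).differentiableAt
    |>.hasDerivAt

theorem contDiff_deriv_θb (hsol : IsSolution L Ra D θ' θb u v w ω ψ) {t : ℝ} (ht : t ∈ D) :
    ContDiff ℝ (⊤ : ℕ∞) (deriv fun s => θb s t) := by
  have hB := (smoothF4_profile hsol.smooth_θb).contDiff_slice ht
  have h : deriv (fun s => θb s t)
      = fun z => dirDeriv ez (slice (profile θb) t) ((0, 0), z) :=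
    funext fun z => (hasDerivAt_z hB (0, 0) z).deriv
  rw [h]
  exact (contDiff_dirDeriv hB ez).comp (by fun_prop)

/-- The mean temperature gradient balances the vertical heat flux up to a constant. -/
theorem exists_flux_const (hL : 0 < L) (hsol : IsSolution L Ra D θ' θb u v w ω ψ) {t : ℝ}
    (ht : t ∈ D) : ∃ k, ∀ z, ∫ q, (deriv (fun s => θb s t) z
      - slice θ' t (q, z) * slice w t (q, z)) ∂squareMeasure (2 * π * L) = k := by
  have ha : 0 ≤ 2 * π * L := by positivity
  have hP := (hsol.smooth_θ'.smoothPeriodic_slice hsol.per_θ' ht).mul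
    (hsol.smooth_w.smoothPeriodic_slice hsol.per_w ht)
  have hPc := hP.continuous
  have hb := hsol.contDiff_deriv_θb ht
  have hflux (z : ℝ) := hP.hasDerivAt_integral_square z
  have hd (z : ℝ) : HasDerivAt (fun z => (2 * π * L) ^ 2 * deriv (fun s => θb s t) z
      - ∫ q, slice θ' t (q, z) * slice w t (q, z) ∂squareMeasure (2 * π * L)) 0 z := by
    have h1 := ((hb.differentiable (by simp) z).hasDerivAt.const_mul ((2 * π * L) ^ 2)).fun_sub
      (hflux z)
    have h2 := hsol.eq_mean z t ht
    have h3 : (fun s => hmean L (fun x y z' t' => θ' x y z' t' * w x y z' t') s t)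
        = fun s => (1 / (4 * π ^ 2 * L ^ 2)) *
          ∫ q, slice θ' t (q, s) * slice w t (q, s) ∂squareMeasure (2 * π * L) :=
      funext fun s => hmean_eq (f := fun x y z' t' => θ' x y z' t' * w x y z' t') (t := t) hL hPc s
    rw [h3, ((hflux z).const_mul _).deriv] at h2
    have h4 : (2 * π * L) ^ 2 * deriv (deriv fun s => θb s t) z
        - ∫ p, dirDeriv ez (fun q => slice θ' t q * slice w t q) (p, z)
          ∂squareMeasure (2 * π * L) = 0 := by
      rw [← h2]
      field_simp
      ring
    rw [h4] at h1
    exact h1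
  refine ⟨(2 * π * L) ^ 2 * deriv (fun s => θb s t) 0
    - ∫ q, slice θ' t (q, 0) * slice w t (q, 0) ∂squareMeasure (2 * π * L), fun z => ?_⟩
  have hPz : Continuous fun q => slice θ' t (q, z) * slice w t (q, z) :=
    hPc.comp (by fun_prop : Continuous fun q => (q, z))
  rw [integral_sub (integrable_const _) (hPz.integrable_square _),
    integral_square continuous_const]
  simp only [integral_cell_const ha]
  rw [← mul_assoc, ← sq]
  exact is_const_of_deriv_eq_zero (fun z => (hd z).differentiableAt) (fun z => (hd z).deriv) z 0

variable {θ'₂ : F4} {θb₂ : ℝ → ℝ → ℝ} {u₂ v₂ w₂ ω₂ ψ₂ : F4}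

theorem profile_sub_estimate (hL : 0 < L) (hsol : IsSolution L Ra D θ' θb u v w ω ψ)
    (hsol₂ : IsSolution L Ra D θ'₂ θb₂ u₂ v₂ w₂ ω₂ ψ₂) {t : ℝ} (ht : t ∈ D) :
    ∫ p, (deriv (fun s => θb s t) p.2 - deriv (fun s => θb₂ s t) p.2) ^ 2
        ∂boxMeasure (2 * π * L) (2 * π)
      ≤ ∫ p, (slice θ' t p * slice w t p - slice θ'₂ t p * slice w₂ t p) ^ 2
        ∂boxMeasure (2 * π * L) (2 * π) := by
  obtain ⟨k, hk⟩ := hsol.exists_flux_const hL ht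
  obtain ⟨k₂, hk₂⟩ := hsol₂.exists_flux_const hL ht
  have hb := (hsol.contDiff_deriv_θb ht).continuous
  have hb₂ := (hsol₂.contDiff_deriv_θb ht).continuous
  have hθ := (hsol.smooth_θ'.contDiff_slice ht).continuous
  have hθ₂ := (hsol₂.smooth_θ'.contDiff_slice ht).continuous
  have hw := (hsol.smooth_w.contDiff_slice ht).continuous
  have hw₂ := (hsol₂.smooth_w.contDiff_slice ht).continuous
  refine profile_estimate (k := k - k₂)
    (β := fun z => deriv (fun s => θb s t) z - deriv (fun s => θb₂ s t) z)
    (G := fun p => slice θ' t p * slice w t p - slice θ'₂ t p * slice w₂ t p)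
    (by fun_prop) (by fun_prop) ?_ fun z => ?_
  · rw [integral_cell (by positivity), intervalIntegral.integral_eq_sub_of_hasDerivAt
      (fun z _ => (hsol.hasDerivAt_θb ht z).sub (hsol₂.hasDerivAt_θb ht z))
      (Continuous.intervalIntegrable (by fun_prop) _ _)]
    have h1 := hsol.per_θb 0 t
    have h2 := hsol₂.per_θb 0 t
    rw [zero_add] at h1 h2
    simp [h1, h2]
  · rw [← hk z, ← hk₂ z, ← integral_sub]
    · congr 1 with q
      ring
    all_goals exact Continuous.integrable_square (by fun_prop) _

theorem velocity_sub_estimate (hL : 0 < L) (hsol : IsSolution L Ra D θ' θb u v w ω ψ)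
    (hsol₂ : IsSolution L Ra D θ'₂ θb₂ u₂ v₂ w₂ ω₂ ψ₂) {t : ℝ} (ht : t ∈ D) :
    ∫ p, (slice w t p - slice w₂ t p) ^ 2 ∂boxMeasure (2 * π * L) (2 * π)
      ≤ 4 * (2 * π * L) ^ 4 * Ra ^ 2
        * ∫ p, (slice θ' t p - slice θ'₂ t p) ^ 2 ∂boxMeasure (2 * π * L) (2 * π) ∧
    ∫ p, (slice u t p - slice u₂ t p) ^ 2 ∂boxMeasure (2 * π * L) (2 * π)
        + ∫ p, (slice v t p - slice v₂ t p) ^ 2 ∂boxMeasure (2 * π * L) (2 * π)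
      ≤ 2 * (2 * π * L) ^ 4 * Ra ^ 2
        * ∫ p, (slice θ' t p - slice θ'₂ t p) ^ 2 ∂boxMeasure (2 * π * L) (2 * π) := by
  have hθ := hsol.smooth_θ'.smoothPeriodic_slice hsol.per_θ' ht
  have hθ₂ := hsol₂.smooth_θ'.smoothPeriodic_slice hsol₂.per_θ' ht
  have hw := hsol.smooth_w.smoothPeriodic_slice hsol.per_w ht
  have hw₂ := hsol₂.smooth_w.smoothPeriodic_slice hsol₂.per_w ht
  have hω := hsol.smooth_ω.smoothPeriodic_slice hsol.per_ω ht
  have hω₂ := hsol₂.smooth_ω.smoothPeriodic_slice hsol₂.per_ω ht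
  have hψ := hsol.smooth_ψ.smoothPeriodic_slice hsol.per_ψ ht
  have hψ₂ := hsol₂.smooth_ψ.smoothPeriodic_slice hsol₂.per_ψ ht
  have hlap {f g : (ℝ × ℝ) × ℝ → ℝ} (hf : ContDiff ℝ (⊤ : ℕ∞) f) (hg : ContDiff ℝ (⊤ : ℕ∞) g)
      (e p : (ℝ × ℝ) × ℝ) : dirDeriv e (dirDeriv e fun q => f q - g q) p
        = dirDeriv e (dirDeriv e f) p - dirDeriv e (dirDeriv e g) p := by
    rw [dirDeriv_sub hf hg, dirDeriv_sub (contDiff_dirDeriv hf e) (contDiff_dirDeriv hg e)]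
  have hmean {f g : F4} (hf : Continuous (slice f t)) (hg : Continuous (slice g t))
      (h1 : ∀ z, hmean L f z t = 0) (h2 : ∀ z, hmean L g z t = 0) (z : ℝ) :
      ∫ q, (slice f t (q, z) - slice g t (q, z)) ∂squareMeasure (2 * π * L) = 0 := by
    rw [integral_sub, integral_eq_zero_of_hmean_eq_zero hL hf (h1 z),
      integral_eq_zero_of_hmean_eq_zero hL hg (h2 z), sub_zero]
    all_goals exact Continuous.integrable_square (by fun_prop) _
  have key := SmoothPeriodic.velocity_estimate (a := 2 * π * L) (c := 2 * π) (by positivity)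
    (by positivity) Ra (hθ.sub hθ₂) (hw.sub hw₂) (hω.sub hω₂) (hψ.sub hψ₂) (fun p => ?_)
    (fun p => ?_) (fun p => ?_)
    (hmean hw.continuous hw₂.continuous (hsol.mean_w · t ht) (hsol₂.mean_w · t ht))
    (hmean hψ.continuous hψ₂.continuous (hsol.mean_ψ · t ht) (hsol₂.mean_ψ · t ht))
  · have hu (p : (ℝ × ℝ) × ℝ) : slice u t p - slice u₂ t p
        = -dirDeriv ey (fun q => slice ψ t q - slice ψ₂ t q) p := by
      rw [dirDeriv_sub hψ.contDiff hψ₂.contDiff, ← slice_py hψ.contDiff, ← slice_py hψ₂.contDiff]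
      simp only [slice]
      rw [hsol.def_u _ _ _ t ht, hsol₂.def_u _ _ _ t ht]
      ring
    have hv (p : (ℝ × ℝ) × ℝ) : slice v t p - slice v₂ t p
        = dirDeriv ex (fun q => slice ψ t q - slice ψ₂ t q) p := by
      rw [dirDeriv_sub hψ.contDiff hψ₂.contDiff, ← slice_px hψ.contDiff, ← slice_px hψ₂.contDiff]
      simp only [slice]
      rw [hsol.def_v _ _ _ t ht, hsol₂.def_v _ _ _ t ht]
    simp only [hu, hv, neg_sq]
    exact ⟨key.1, by rw [add_comm]; exact key.2⟩
  · rw [hlap hw.contDiff hw₂.contDiff, hlap hw.contDiff hw₂.contDiff,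
      dirDeriv_sub hψ.contDiff hψ₂.contDiff, ← slice_pz hψ.contDiff, ← slice_pz hψ₂.contDiff]
    have h1 := slice_lapH hw.contDiff p
    have h2 := slice_lapH hw₂.contDiff p
    have h3 := hsol.eq_psi p.1.1 p.1.2 p.2 t ht
    have h4 := hsol₂.eq_psi p.1.1 p.1.2 p.2 t ht
    simp only [slice] at h1 h2 ⊢
    linarith
  · rw [hlap hω.contDiff hω₂.contDiff, hlap hω.contDiff hω₂.contDiff,
      dirDeriv_sub hw.contDiff hw₂.contDiff, ← slice_pz hw.contDiff, ← slice_pz hw₂.contDiff]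
    have h1 := slice_lapH hω.contDiff p
    have h2 := slice_lapH hω₂.contDiff p
    have h3 := hsol.eq_w p.1.1 p.1.2 p.2 t ht
    have h4 := hsol₂.eq_w p.1.1 p.1.2 p.2 t ht
    simp only [slice] at h1 h2 ⊢
    linarith
  · rw [hlap hψ.contDiff hψ₂.contDiff, hlap hψ.contDiff hψ₂.contDiff]
    have h1 := slice_lapH hψ.contDiff p
    have h2 := slice_lapH hψ₂.contDiff p
    have h3 := hsol.def_ψ p.1.1 p.1.2 p.2 t ht
    have h4 := hsol₂.def_ψ p.1.1 p.1.2 p.2 t ht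
    simp only [slice] at h1 h2 ⊢
    linarith

/-- The `L²` energy of the temperature difference grows at most exponentially. -/
theorem exists_energy_estimate {T : ℝ} (hL : 0 < L) (hT : 0 < T)
    (hsol : IsSolution L Ra (Icc 0 T) θ' θb u v w ω ψ)
    (hsol₂ : IsSolution L Ra (Icc 0 T) θ'₂ θb₂ u₂ v₂ w₂ ω₂ ψ₂) :
    ∃ K, ∀ t ∈ Ioo 0 T,
      ∫ p, 2 * (slice θ' t p - slice θ'₂ t p) * slice (spaceTimeDeriv T (0, 0, 0, 1)
          fun x y z t => θ' x y z t - θ'₂ x y z t) t p ∂boxMeasure (2 * π * L) (2 * π)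
        ≤ K * ∫ p, (slice θ' t p - slice θ'₂ t p) ^ 2 ∂boxMeasure (2 * π * L) (2 * π) := by
  have hsm := hsol.smooth_θ'
  have hsm₂ := hsol₂.smooth_θ'
  have hprof := smoothF4_profile hsol₂.smooth_θb
  have hbox := isCompact_box (2 * π * L) (2 * π)
  obtain ⟨C₁, hC₁⟩ := (hsm₂.spaceTimeDeriv hT (1, 0, 0, 0)).exists_bound hbox
  obtain ⟨C₂, hC₂⟩ := (hsm₂.spaceTimeDeriv hT (0, 1, 0, 0)).exists_bound hbox
  obtain ⟨C₃, hC₃⟩ := hsol.smooth_w.exists_bound hbox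
  obtain ⟨C₄, hC₄⟩ := (hprof.spaceTimeDeriv hT (0, 0, 1, 0)).exists_bound hbox
  obtain ⟨C₅, hC₅⟩ := hsm₂.exists_bound hbox
  set C := |C₁| + |C₂| + |C₃| + |C₄| + |C₅| with hC
  have b1 := le_abs_self C₁
  have b2 := le_abs_self C₂
  have b3 := le_abs_self C₃
  have b4 := le_abs_self C₄
  have b5 := le_abs_self C₅
  have n1 := abs_nonneg C₁
  have n2 := abs_nonneg C₂
  have n3 := abs_nonneg C₃
  have n4 := abs_nonneg C₄
  have n5 := abs_nonneg C₅
  have hC0 : 0 ≤ C := by positivity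
  set Kw := 4 * (2 * π * L) ^ 4 * Ra ^ 2 with hKw
  set Ku := 2 * (2 * π * L) ^ 4 * Ra ^ 2 with hKu
  refine ⟨C * (4 + Ku + 2 * C ^ 2 * (1 + Kw) + Kw), fun t ht' => ?_⟩
  have ht := Ioo_subset_Icc_self ht'
  obtain ⟨hwE, huE⟩ := hsol.velocity_sub_estimate hL hsol₂ ht
  have hβE := hsol.profile_sub_estimate hL hsol₂ ht
  have hθ := hsm.smoothPeriodic_slice hsol.per_θ' ht
  have hθ₂ := hsm₂.smoothPeriodic_slice hsol₂.per_θ' ht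
  have hu := hsol.smooth_u.smoothPeriodic_slice hsol.per_u ht
  have hv := hsol.smooth_v.smoothPeriodic_slice hsol.per_v ht
  have hw := hsol.smooth_w.smoothPeriodic_slice hsol.per_w ht
  have huc := hu.continuous
  have hvc := hv.continuous
  have hwc := hw.continuous
  have hθc := hθ.continuous
  have hθc₂ := hθ₂.continuous
  have huc₂ := (hsol₂.smooth_u.contDiff_slice ht).continuous
  have hvc₂ := (hsol₂.smooth_v.contDiff_slice ht).continuous
  have hwc₂ := (hsol₂.smooth_w.contDiff_slice ht).continuous
  have hb := (hsol.contDiff_deriv_θb ht).continuous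
  have hb₂ := (hsol₂.contDiff_deriv_θb ht).continuous
  have hX := (hθ₂.dirDeriv ex).continuous
  have hY := (hθ₂.dirDeriv ey).continuous
  have hG : ∫ p, (slice θ' t p * slice w t p - slice θ'₂ t p * slice w₂ t p) ^ 2
        ∂boxMeasure (2 * π * L) (2 * π)
      ≤ ∫ p, 2 * C ^ 2 * ((slice θ' t p - slice θ'₂ t p) ^ 2 + (slice w t p - slice w₂ t p) ^ 2)
        ∂boxMeasure (2 * π * L) (2 * π) := by
    refine integral_mono_ae (Continuous.integrable_box (by fun_prop) _ _)
      (Continuous.integrable_box (by fun_prop) _ _) ?_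
    filter_upwards [ae_mem_box (2 * π * L) (2 * π)] with p hp
    have i1 : slice w t p ^ 2 ≤ C ^ 2 := sq_le_sq' (by linarith [abs_le.mp (hC₃ t ht p hp)])
      (by linarith [abs_le.mp (hC₃ t ht p hp)])
    have i2 : slice θ'₂ t p ^ 2 ≤ C ^ 2 := sq_le_sq' (by linarith [abs_le.mp (hC₅ t ht p hp)])
      (by linarith [abs_le.mp (hC₅ t ht p hp)])
    have i3 := mul_le_mul_of_nonneg_left i1 (sq_nonneg (slice θ' t p - slice θ'₂ t p))
    have i4 := mul_le_mul_of_nonneg_left i2 (sq_nonneg (slice w t p - slice w₂ t p))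
    nlinarith [sq_nonneg ((slice θ' t p - slice θ'₂ t p) * slice w t p
      - (slice w t p - slice w₂ t p) * slice θ'₂ t p)]
  rw [integral_const_mul, integral_add (Continuous.integrable_box (by fun_prop) _ _)
    (Continuous.integrable_box (by fun_prop) _ _)] at hG
  have key := SmoothPeriodic.energy_estimate (a := 2 * π * L) (c := 2 * π) (C := C) (by positivity)
    (θ := fun p => slice θ' t p - slice θ'₂ t p)
    (θt := slice (spaceTimeDeriv T (0, 0, 0, 1) fun x y z t => θ' x y z t - θ'₂ x y z t) t)
    (u := fun p => slice u t p - slice u₂ t p) (v := fun p => slice v t p - slice v₂ t p)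
    (w := fun p => slice w t p - slice w₂ t p)
    (β := fun p => deriv (fun s => θb s t) p.2 - deriv (fun s => θb₂ s t) p.2)
    (B := fun p => deriv (fun s => θb₂ s t) p.2)
    (hθ.sub hθ₂) hu hv (by fun_prop) (by fun_prop) (by fun_prop) hwc hX hY (by fun_prop)
    (by fun_prop) (fun p => ?_) (fun p => ?_) (fun p hp => ?_)
  · refine key.trans ?_
    rw [mul_assoc C]
    refine mul_le_mul_of_nonneg_left ?_ hC0
    have := mul_le_mul_of_nonneg_left hwE (by positivity : 0 ≤ 2 * C ^ 2)
    linarith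
  · rw [← slice_px hu.contDiff, ← slice_py hv.contDiff]
    exact hsol.div_free _ _ _ t ht
  · have hd := (hsm.sub hsm₂).hasDerivAt_time p.1.1 p.1.2 p.2 ht'
    have hd₁ := hsm.hasDerivAt_time p.1.1 p.1.2 p.2 ht'
    have hd₂ := hsm₂.hasDerivAt_time p.1.1 p.1.2 p.2 ht'
    have e0 := hd.unique (hd₁.sub hd₂)
    rw [← hd₁.deriv, ← hd₂.deriv] at e0
    have e1 := hsol.eq_heat p.1.1 p.1.2 p.2 t ht
    have e2 := hsol₂.eq_heat p.1.1 p.1.2 p.2 t ht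
    have l1 := slice_lapH hθ.contDiff p
    have l2 := slice_lapH hθ₂.contDiff p
    rw [dirDeriv_sub hθ.contDiff hθ₂.contDiff, dirDeriv_sub hθ.contDiff hθ₂.contDiff,
      dirDeriv_sub (contDiff_dirDeriv hθ.contDiff ex) (contDiff_dirDeriv hθ₂.contDiff ex),
      dirDeriv_sub (contDiff_dirDeriv hθ.contDiff ey) (contDiff_dirDeriv hθ₂.contDiff ey)]
    simp only [← slice_px hθ.contDiff, ← slice_px hθ₂.contDiff, ← slice_py hθ.contDiff,
      ← slice_py hθ₂.contDiff] at l1 l2 ⊢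
    simp only [slice, pt] at *
    linarith
  · have hx := hsm₂.px_eq p.1.1 p.1.2 p.2 ht
    have hy := hsm₂.py_eq p.1.1 p.1.2 p.2 ht
    have hz := hprof.pz_eq p.1.1 p.1.2 p.2 ht
    have c1 := hC₁ t ht p hp
    have c2 := hC₂ t ht p hp
    have c3 := hC₃ t ht p hp
    have c4 := hC₄ t ht p hp
    rw [← slice_px hθ₂.contDiff, ← slice_py hθ₂.contDiff]
    simp only [slice] at c1 c2 c3 c4 ⊢
    rw [← hx] at c1
    rw [← hy] at c2
    rw [← hz] at c4
    simp only [pz, profile] at c4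
    exact ⟨by linarith, by linarith, by linarith, by linarith⟩

end IsSolution

/-- **Grönwall's inequality** for a nonnegative quantity starting from zero. -/
theorem eq_zero_of_deriv_le_mul {T K : ℝ} {E E' : ℝ → ℝ} (hc : ContinuousOn E (Icc 0 T))
    (hd : ∀ t ∈ Ioo 0 T, HasDerivAt E (E' t) t) (hE' : ∀ t ∈ Ioo 0 T, E' t ≤ K * E t)
    (h0 : E 0 = 0) (hnn : ∀ t ∈ Icc 0 T, 0 ≤ E t) : ∀ t ∈ Icc 0 T, E t = 0 := by
  intro t ht
  have hder (s : ℝ) (hs : s ∈ Ioo 0 T) : HasDerivAt (fun s => E s * exp (-K * s))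
      (E' s * exp (-K * s) + E s * (exp (-K * s) * (-K))) s := by
    have := ((hasDerivAt_id s).const_mul (-K)).exp
    simp only [id, mul_one] at this
    exact (hd s hs).mul this
  have hanti : AntitoneOn (fun s => E s * exp (-K * s)) (Icc 0 T) := by
    refine antitoneOn_of_deriv_nonpos (convex_Icc 0 T)
      (hc.mul (by fun_prop)) (fun s hs => ?_) (fun s hs => ?_)
    · rw [interior_Icc] at hs
      exact (hder s hs).differentiableAt.differentiableWithinAt
    · rw [interior_Icc] at hs
      rw [(hder s hs).deriv]
      nlinarith [hE' s hs, exp_pos (-K * s)]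
  have := hanti ⟨le_rfl, ht.1.trans ht.2⟩ ht ht.1
  simp only [h0, zero_mul] at this
  exact le_antisymm (nonpos_of_mul_nonpos_left this (exp_pos _)) (hnn t ht)

end Preliminaries

/-- Uniqueness of smooth solutions of the infinite-Prandtl-number convection system:
two solutions on `ℝ³ × [0,T]` with the same initial temperature fluctuation coincide. -/
theorem uniqueness_of_solutions (L Ra T : ℝ) (hL : 0 < L) (hT : 0 < T)
    (θ'₁ : F4) (θb₁ : ℝ → ℝ → ℝ) (u₁ v₁ w₁ ω₁ ψ₁ : F4)
    (θ'₂ : F4) (θb₂ : ℝ → ℝ → ℝ) (u₂ v₂ w₂ ω₂ ψ₂ : F4)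
    (hsol₁ : IsSolution L Ra (Set.Icc 0 T) θ'₁ θb₁ u₁ v₁ w₁ ω₁ ψ₁)
    (hsol₂ : IsSolution L Ra (Set.Icc 0 T) θ'₂ θb₂ u₂ v₂ w₂ ω₂ ψ₂)
    (hinit : ∀ x y z : ℝ, θ'₁ x y z 0 = θ'₂ x y z 0) :
    ∀ t ∈ Set.Icc (0:ℝ) T,
      (∀ x y z : ℝ, θ'₁ x y z t = θ'₂ x y z t) ∧
      (∀ x y z : ℝ, u₁ x y z t = u₂ x y z t) ∧
      (∀ x y z : ℝ, v₁ x y z t = v₂ x y z t) ∧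
      (∀ x y z : ℝ, w₁ x y z t = w₂ x y z t) ∧
      (∀ z : ℝ, θb₁ z t = θb₂ z t) := by
  intro t ht
  have ha : 0 < 2 * π * L := by positivity
  have hc : 0 < 2 * π := by positivity
  obtain ⟨K, hK⟩ := hsol₁.exists_energy_estimate hL hT hsol₂
  have hdiff := hsol₁.smooth_θ'.sub hsol₂.smooth_θ'
  have hE := eq_zero_of_deriv_le_mul
    (hdiff.continuousOn_integral_sq hT.le (2 * π * L) (2 * π))
    (fun s hs => hdiff.hasDerivAt_integral_sq hT (2 * π * L) (2 * π) hs) hK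
    (by simp [slice, hinit]) (fun s _ => MeasureTheory.integral_nonneg fun p => sq_nonneg _) t ht
  replace hE : ∫ p, (slice θ'₁ t p - slice θ'₂ t p) ^ 2 ∂boxMeasure (2 * π * L) (2 * π) = 0 := hE
  obtain ⟨hwE, huvE⟩ := hsol₁.velocity_sub_estimate hL hsol₂ ht
  have hβE := hsol₁.profile_sub_estimate hL hsol₂ ht
  rw [hE, mul_zero] at hwE huvE
  have hsqu : 0 ≤ ∫ p, (slice u₁ t p - slice u₂ t p) ^ 2 ∂boxMeasure (2 * π * L) (2 * π) :=
    MeasureTheory.integral_nonneg fun p => sq_nonneg _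
  have hsqv : 0 ≤ ∫ p, (slice v₁ t p - slice v₂ t p) ^ 2 ∂boxMeasure (2 * π * L) (2 * π) :=
    MeasureTheory.integral_nonneg fun p => sq_nonneg _
  have heq {f g : F4} (hf : SmoothF4 f (Set.Icc 0 T)) (hg : SmoothF4 g (Set.Icc 0 T))
      (hfp : PeriodicF4 L f) (hgp : PeriodicF4 L g)
      (h : ∫ p, (slice f t p - slice g t p) ^ 2 ∂boxMeasure (2 * π * L) (2 * π) ≤ 0)
      (x y z : ℝ) : f x y z t = g x y z t :=
    sub_eq_zero.mp (((hf.smoothPeriodic_slice hfp ht).sub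
      (hg.smoothPeriodic_slice hgp ht)).eq_zero_of_integral_sq_nonpos ha hc h ((x, y), z))
  have hθ := heq hsol₁.smooth_θ' hsol₂.smooth_θ' hsol₁.per_θ' hsol₂.per_θ' hE.le
  have hw := heq hsol₁.smooth_w hsol₂.smooth_w hsol₁.per_w hsol₂.per_w hwE
  refine ⟨hθ, heq hsol₁.smooth_u hsol₂.smooth_u hsol₁.per_u hsol₂.per_u (by linarith),
    heq hsol₁.smooth_v hsol₂.smooth_v hsol₁.per_v hsol₂.per_v (by linarith), hw, ?_⟩
  have hB {b : ℝ → ℝ → ℝ} (hb : ContDiffOn ℝ (⊤ : ℕ∞) (fun p : ℝ × ℝ => b p.1 p.2)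
      {p : ℝ × ℝ | p.2 ∈ Set.Icc 0 T}) (hper : ∀ z t, b (z + 2 * π) t = b z t) :
      SmoothPeriodic (2 * π * L) (2 * π) (slice (profile b) t) :=
    (smoothF4_profile hb).smoothPeriodic_slice
      ⟨fun _ _ _ _ => rfl, fun _ _ _ _ => rfl, fun _ _ z t => hper z t⟩ ht
  have hB₁ := hB hsol₁.smooth_θb hsol₁.per_θb
  have hB₂ := hB hsol₂.smooth_θb hsol₂.per_θb
  have hβ : ∀ z, deriv (fun s => θb₁ s t) z - deriv (fun s => θb₂ s t) z = 0 := by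
    have h := ((hB₁.dirDeriv ez).sub (hB₂.dirDeriv ez)).eq_zero_of_integral_sq_nonpos ha hc
    simp only [← slice_pz hB₁.contDiff, ← slice_pz hB₂.contDiff] at h
    refine fun z => h (hβE.trans ?_) ((0, 0), z)
    simp [slice, hθ, hw]
  have hconst (z : ℝ) : θb₁ z t - θb₂ z t = θb₁ 0 t - θb₂ 0 t := by
    have hd (s : ℝ) := (hsol₁.hasDerivAt_θb ht s).fun_sub (hsol₂.hasDerivAt_θb ht s)
    exact is_const_of_deriv_eq_zero (f := fun s => θb₁ s t - θb₂ s t)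
      (fun s => (hd s).differentiableAt) (fun s => (hd s).deriv.trans (hβ s)) z 0
  have hcont₁ : Continuous fun z => θb₁ z t :=
    hB₁.continuous.comp (by fun_prop : Continuous fun z : ℝ => (((0 : ℝ), (0 : ℝ)), z))
  have hcont₂ : Continuous fun z => θb₂ z t :=
    hB₂.continuous.comp (by fun_prop : Continuous fun z : ℝ => (((0 : ℝ), (0 : ℝ)), z))
  have hint := intervalIntegral.integral_sub (μ := MeasureTheory.volume)
    (hcont₁.intervalIntegrable 0 (2 * π)) (hcont₂.intervalIntegrable 0 (2 * π))
  rw [hsol₁.mean_θb t ht, hsol₂.mean_θb t ht] at hint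
  simp only [hconst, intervalIntegral.integral_const, sub_zero, smul_eq_mul] at hint
  have h0 := (mul_eq_zero.mp hint).resolve_left hc.ne'
  intro z
  linarith [hconst z]
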